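/- Theorem 3 (Han–Kobayashi auxiliary region via SWSC layer orders): Let p denote the pmf p(s)p(t)p(u)p(v) together with functions x(s,t), w(u,v). Then 𝓡₁,MAC(p) ∩ 𝓡₂,MAC(p) = ⋃_{p' ≃ p} ⋃_{λ₁=1}^{6} ⋃_{λ₂=7}^{12} [𝓡₁(p',λ₁) ∩ 𝓡₂(p',λ₂)], where λ₁ ranges over the six layer orders at receiver 1 (e.g., λ₁=1: S₁→T₁→S₂→S₃→U→T₂) and λ₂ over the six corresponding layer orders at receiver 2 obtained by replacing T₁,T₂ with V₁,V₂. -/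

import Mathlib

open scoped BigOperators Classical

noncomputable section

/-- Pushforward of a finitely supported weight function along a map. -/
def pushf {Ω β : Type*} [Fintype Ω] (q : Ω → ℝ) (f : Ω → β) : β → ℝ :=
  fun b => ∑ ω, if f ω = b then q ω else 0

/-- Shannon entropy (in nats). -/
def ent {β : Type*} [Fintype β] (p : β → ℝ) : ℝ :=
  -∑ b, p b * Real.log (p b)

/-- Entropy of the random variable `A` under the joint pmf `q`. -/
def Hof {Ω β : Type*} [Fintype Ω] [Fintype β] (q : Ω → ℝ) (A : Ω → β) : ℝ :=
  ent (pushf q A)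

/-- Mutual information `I(A;B)` under the joint pmf `q`. -/
def miOf {Ω α β : Type*} [Fintype Ω] [Fintype α] [Fintype β]
    (q : Ω → ℝ) (A : Ω → α) (B : Ω → β) : ℝ :=
  Hof q A + Hof q B - Hof q (fun ω => (A ω, B ω))

/-- Conditional mutual information `I(A;B|C)` under the joint pmf `q`. -/
def cmiOf {Ω α β γ : Type*} [Fintype Ω] [Fintype α] [Fintype β] [Fintype γ]
    (q : Ω → ℝ) (A : Ω → α) (B : Ω → β) (C : Ω → γ) : ℝ :=
  Hof q (fun ω => (A ω, C ω)) + Hof q (fun ω => (B ω, C ω))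
    - Hof q (fun ω => (A ω, B ω, C ω)) - Hof q C

/-- `p` is a probability mass function. -/
def IsPMF {α : Type*} [Fintype α] (p : α → ℝ) : Prop :=
  (∀ a, 0 ≤ p a) ∧ ∑ a, p a = 1

/-- A refined split distribution for the Han–Kobayashi scheme: independent layers
`S₁,S₂,S₃,T₁,T₂,V₁,V₂` with recombination maps `fs, ft, fv`. -/
structure HKSplit (𝒮 𝒯 𝒰 𝒱 : Type) [Fintype 𝒮] [Fintype 𝒯] [Fintype 𝒰] [Fintype 𝒱] where
  S1 : Type
  S2 : Type
  S3 : Type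
  T1 : Type
  T2 : Type
  V1 : Type
  V2 : Type
  [finS1 : Fintype S1]
  [finS2 : Fintype S2]
  [finS3 : Fintype S3]
  [finT1 : Fintype T1]
  [finT2 : Fintype T2]
  [finV1 : Fintype V1]
  [finV2 : Fintype V2]
  pS1 : S1 → ℝ
  pS2 : S2 → ℝ
  pS3 : S3 → ℝ
  pT1 : T1 → ℝ
  pT2 : T2 → ℝ
  pV1 : V1 → ℝ
  pV2 : V2 → ℝ
  fs : S1 → S2 → S3 → 𝒮
  ft : T1 → T2 → 𝒯
  fv : V1 → V2 → 𝒱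
  pS1_pmf : IsPMF pS1
  pS2_pmf : IsPMF pS2
  pS3_pmf : IsPMF pS3
  pT1_pmf : IsPMF pT1
  pT2_pmf : IsPMF pT2
  pV1_pmf : IsPMF pV1
  pV2_pmf : IsPMF pV2

attribute [instance] HKSplit.finS1 HKSplit.finS2 HKSplit.finS3 HKSplit.finT1
  HKSplit.finT2 HKSplit.finV1 HKSplit.finV2

/-- `p' ≃ p`: the induced laws of `S = fs(S₁,S₂,S₃)`, `T = ft(T₁,T₂)`, `V = fv(V₁,V₂)`
match `pS`, `pT`, `pV`. -/
def HKSplit.Matches {𝒮 𝒯 𝒰 𝒱 : Type} [Fintype 𝒮] [Fintype 𝒯] [Fintype 𝒰] [Fintype 𝒱]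
    (s : HKSplit 𝒮 𝒯 𝒰 𝒱) (pS : 𝒮 → ℝ) (pT : 𝒯 → ℝ) (pV : 𝒱 → ℝ) : Prop :=
  (∀ a, pushf (fun x : s.S1 × s.S2 × s.S3 => s.pS1 x.1 * s.pS2 x.2.1 * s.pS3 x.2.2)
      (fun x => s.fs x.1 x.2.1 x.2.2) a = pS a) ∧
  (∀ a, pushf (fun x : s.T1 × s.T2 => s.pT1 x.1 * s.pT2 x.2)
      (fun x => s.ft x.1 x.2) a = pT a) ∧
  (∀ a, pushf (fun x : s.V1 × s.V2 => s.pV1 x.1 * s.pV2 x.2)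
      (fun x => s.fv x.1 x.2) a = pV a)

variable {𝒮 𝒯 𝒰 𝒱 𝒳 𝒲 𝒴₁ 𝒴₂ : Type}
  [Fintype 𝒮] [Fintype 𝒯] [Fintype 𝒰] [Fintype 𝒱]
  [Fintype 𝒳] [Fintype 𝒲] [Fintype 𝒴₁] [Fintype 𝒴₂]

/-- Joint pmf on `(S, T, U, V, Y₁, Y₂)` for the Han–Kobayashi scheme. -/
def hkBaseJoint (pS : 𝒮 → ℝ) (pT : 𝒯 → ℝ) (pU : 𝒰 → ℝ) (pV : 𝒱 → ℝ)
    (fx : 𝒮 → 𝒯 → 𝒳) (fw : 𝒰 → 𝒱 → 𝒲)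
    (ch : 𝒳 → 𝒲 → 𝒴₁ → 𝒴₂ → ℝ) : 𝒮 × 𝒯 × 𝒰 × 𝒱 × 𝒴₁ × 𝒴₂ → ℝ :=
  fun ω => pS ω.1 * pT ω.2.1 * pU ω.2.2.1 * pV ω.2.2.2.1 *
    ch (fx ω.1 ω.2.1) (fw ω.2.2.1 ω.2.2.2.1) ω.2.2.2.2.1 ω.2.2.2.2.2

/-- `𝓡₁,MAC`: quadruples `(R₁₀,R₁₁,R₂₀,R₂₂)` with `(R₁₀,R₁₁,R₂₀) ∈ 𝓡_MAC(S,T,U;Y₁)`. -/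
def R1MACHK (pS : 𝒮 → ℝ) (pT : 𝒯 → ℝ) (pU : 𝒰 → ℝ) (pV : 𝒱 → ℝ)
    (fx : 𝒮 → 𝒯 → 𝒳) (fw : 𝒰 → 𝒱 → 𝒲)
    (ch : 𝒳 → 𝒲 → 𝒴₁ → 𝒴₂ → ℝ) : Set (ℝ × ℝ × ℝ × ℝ) :=
  {r | 0 ≤ r.1 ∧ 0 ≤ r.2.1 ∧ 0 ≤ r.2.2.1 ∧ 0 ≤ r.2.2.2 ∧
    r.1 ≤ cmiOf (hkBaseJoint pS pT pU pV fx fw ch) (fun ω => ω.1)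
      (fun ω => ω.2.2.2.2.1) (fun ω => (ω.2.1, ω.2.2.1)) ∧
    r.2.1 ≤ cmiOf (hkBaseJoint pS pT pU pV fx fw ch) (fun ω => ω.2.1)
      (fun ω => ω.2.2.2.2.1) (fun ω => (ω.1, ω.2.2.1)) ∧
    r.2.2.1 ≤ cmiOf (hkBaseJoint pS pT pU pV fx fw ch) (fun ω => ω.2.2.1)
      (fun ω => ω.2.2.2.2.1) (fun ω => (ω.1, ω.2.1)) ∧
    r.1 + r.2.1 ≤ cmiOf (hkBaseJoint pS pT pU pV fx fw ch) (fun ω => (ω.1, ω.2.1))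
      (fun ω => ω.2.2.2.2.1) (fun ω => ω.2.2.1) ∧
    r.1 + r.2.2.1 ≤ cmiOf (hkBaseJoint pS pT pU pV fx fw ch) (fun ω => (ω.1, ω.2.2.1))
      (fun ω => ω.2.2.2.2.1) (fun ω => ω.2.1) ∧
    r.2.1 + r.2.2.1 ≤ cmiOf (hkBaseJoint pS pT pU pV fx fw ch) (fun ω => (ω.2.1, ω.2.2.1))
      (fun ω => ω.2.2.2.2.1) (fun ω => ω.1) ∧
    r.1 + r.2.1 + r.2.2.1 ≤ miOf (hkBaseJoint pS pT pU pV fx fw ch)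
      (fun ω => (ω.1, ω.2.1, ω.2.2.1)) (fun ω => ω.2.2.2.2.1)}

/-- `𝓡₂,MAC`: quadruples `(R₁₀,R₁₁,R₂₀,R₂₂)` with `(R₁₀,R₂₀,R₂₂) ∈ 𝓡_MAC(S,U,V;Y₂)`. -/
def R2MACHK (pS : 𝒮 → ℝ) (pT : 𝒯 → ℝ) (pU : 𝒰 → ℝ) (pV : 𝒱 → ℝ)
    (fx : 𝒮 → 𝒯 → 𝒳) (fw : 𝒰 → 𝒱 → 𝒲)
    (ch : 𝒳 → 𝒲 → 𝒴₁ → 𝒴₂ → ℝ) : Set (ℝ × ℝ × ℝ × ℝ) :=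
  {r | 0 ≤ r.1 ∧ 0 ≤ r.2.1 ∧ 0 ≤ r.2.2.1 ∧ 0 ≤ r.2.2.2 ∧
    r.1 ≤ cmiOf (hkBaseJoint pS pT pU pV fx fw ch) (fun ω => ω.1)
      (fun ω => ω.2.2.2.2.2) (fun ω => (ω.2.2.1, ω.2.2.2.1)) ∧
    r.2.2.1 ≤ cmiOf (hkBaseJoint pS pT pU pV fx fw ch) (fun ω => ω.2.2.1)
      (fun ω => ω.2.2.2.2.2) (fun ω => (ω.1, ω.2.2.2.1)) ∧
    r.2.2.2 ≤ cmiOf (hkBaseJoint pS pT pU pV fx fw ch) (fun ω => ω.2.2.2.1)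
      (fun ω => ω.2.2.2.2.2) (fun ω => (ω.1, ω.2.2.1)) ∧
    r.1 + r.2.2.1 ≤ cmiOf (hkBaseJoint pS pT pU pV fx fw ch) (fun ω => (ω.1, ω.2.2.1))
      (fun ω => ω.2.2.2.2.2) (fun ω => ω.2.2.2.1) ∧
    r.1 + r.2.2.2 ≤ cmiOf (hkBaseJoint pS pT pU pV fx fw ch) (fun ω => (ω.1, ω.2.2.2.1))
      (fun ω => ω.2.2.2.2.2) (fun ω => ω.2.2.1) ∧
    r.2.2.1 + r.2.2.2 ≤ cmiOf (hkBaseJoint pS pT pU pV fx fw ch)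
      (fun ω => (ω.2.2.1, ω.2.2.2.1)) (fun ω => ω.2.2.2.2.2) (fun ω => ω.1) ∧
    r.1 + r.2.2.1 + r.2.2.2 ≤ miOf (hkBaseJoint pS pT pU pV fx fw ch)
      (fun ω => (ω.1, ω.2.2.1, ω.2.2.2.1)) (fun ω => ω.2.2.2.2.2)}

/-- Joint pmf on `(S₁,S₂,S₃,T₁,T₂,U,V₁,V₂,Y₁,Y₂)` induced by a refined split `s`,
the pmf `pU` of the unsplit layer `U`, and the channel. -/
def hkJoint (fx : 𝒮 → 𝒯 → 𝒳) (fw : 𝒰 → 𝒱 → 𝒲)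
    (s : HKSplit 𝒮 𝒯 𝒰 𝒱) (pU : 𝒰 → ℝ) (ch : 𝒳 → 𝒲 → 𝒴₁ → 𝒴₂ → ℝ) :
    s.S1 × s.S2 × s.S3 × s.T1 × s.T2 × 𝒰 × s.V1 × s.V2 × 𝒴₁ × 𝒴₂ → ℝ :=
  fun ω => s.pS1 ω.1 * s.pS2 ω.2.1 * s.pS3 ω.2.2.1 * s.pT1 ω.2.2.2.1 *
    s.pT2 ω.2.2.2.2.1 * pU ω.2.2.2.2.2.1 * s.pV1 ω.2.2.2.2.2.2.1 * s.pV2 ω.2.2.2.2.2.2.2.1 *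
    ch (fx (s.fs ω.1 ω.2.1 ω.2.2.1) (s.ft ω.2.2.2.1 ω.2.2.2.2.1))
      (fw ω.2.2.2.2.2.1 (s.fv ω.2.2.2.2.2.2.1 ω.2.2.2.2.2.2.2.1))
      ω.2.2.2.2.2.2.2.2.1 ω.2.2.2.2.2.2.2.2.2
/-- Receiver-1 successive-cancellation region for layer order λ = 1:
`S1 → T1 → S2 → S3 → U → T2`. -/
def R1L1 (fx : 𝒮 → 𝒯 → 𝒳) (fw : 𝒰 → 𝒱 → 𝒲) (s : HKSplit 𝒮 𝒯 𝒰 𝒱) (pU : 𝒰 → ℝ)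
    (ch : 𝒳 → 𝒲 → 𝒴₁ → 𝒴₂ → ℝ) : Set (ℝ × ℝ × ℝ × ℝ) :=
  {r | 0 ≤ r.1 ∧ 0 ≤ r.2.1 ∧ 0 ≤ r.2.2.1 ∧ 0 ≤ r.2.2.2 ∧
    r.1 ≤ miOf (hkJoint fx fw s pU ch) (fun ω => ω.1) (fun ω => ω.2.2.2.2.2.2.2.2.1)
        + cmiOf (hkJoint fx fw s pU ch) (fun ω => ω.2.1) (fun ω => ω.2.2.2.2.2.2.2.2.1) (fun ω => (ω.1, ω.2.2.2.1))
        + cmiOf (hkJoint fx fw s pU ch) (fun ω => ω.2.2.1) (fun ω => ω.2.2.2.2.2.2.2.2.1) (fun ω => (ω.1, ω.2.2.2.1, ω.2.1)) ∧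
    r.2.1 ≤ cmiOf (hkJoint fx fw s pU ch) (fun ω => ω.2.2.2.1) (fun ω => ω.2.2.2.2.2.2.2.2.1) (fun ω => (ω.1))
        + cmiOf (hkJoint fx fw s pU ch) (fun ω => ω.2.2.2.2.1) (fun ω => ω.2.2.2.2.2.2.2.2.1) (fun ω => (ω.1, ω.2.2.2.1, ω.2.1, ω.2.2.1, ω.2.2.2.2.2.1)) ∧
    r.2.2.1 ≤ cmiOf (hkJoint fx fw s pU ch) (fun ω => ω.2.2.2.2.2.1) (fun ω => ω.2.2.2.2.2.2.2.2.1) (fun ω => (ω.1, ω.2.2.2.1, ω.2.1, ω.2.2.1))}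

/-- Receiver-1 successive-cancellation region for layer order λ = 2:
`T1 → U → S1 → T2 → S2 → S3`. -/
def R1L2 (fx : 𝒮 → 𝒯 → 𝒳) (fw : 𝒰 → 𝒱 → 𝒲) (s : HKSplit 𝒮 𝒯 𝒰 𝒱) (pU : 𝒰 → ℝ)
    (ch : 𝒳 → 𝒲 → 𝒴₁ → 𝒴₂ → ℝ) : Set (ℝ × ℝ × ℝ × ℝ) :=
  {r | 0 ≤ r.1 ∧ 0 ≤ r.2.1 ∧ 0 ≤ r.2.2.1 ∧ 0 ≤ r.2.2.2 ∧
    r.1 ≤ cmiOf (hkJoint fx fw s pU ch) (fun ω => ω.1) (fun ω => ω.2.2.2.2.2.2.2.2.1) (fun ω => (ω.2.2.2.1, ω.2.2.2.2.2.1))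
        + cmiOf (hkJoint fx fw s pU ch) (fun ω => ω.2.1) (fun ω => ω.2.2.2.2.2.2.2.2.1) (fun ω => (ω.2.2.2.1, ω.2.2.2.2.2.1, ω.1, ω.2.2.2.2.1))
        + cmiOf (hkJoint fx fw s pU ch) (fun ω => ω.2.2.1) (fun ω => ω.2.2.2.2.2.2.2.2.1) (fun ω => (ω.2.2.2.1, ω.2.2.2.2.2.1, ω.1, ω.2.2.2.2.1, ω.2.1)) ∧
    r.2.1 ≤ miOf (hkJoint fx fw s pU ch) (fun ω => ω.2.2.2.1) (fun ω => ω.2.2.2.2.2.2.2.2.1)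
        + cmiOf (hkJoint fx fw s pU ch) (fun ω => ω.2.2.2.2.1) (fun ω => ω.2.2.2.2.2.2.2.2.1) (fun ω => (ω.2.2.2.1, ω.2.2.2.2.2.1, ω.1)) ∧
    r.2.2.1 ≤ cmiOf (hkJoint fx fw s pU ch) (fun ω => ω.2.2.2.2.2.1) (fun ω => ω.2.2.2.2.2.2.2.2.1) (fun ω => (ω.2.2.2.1))}

/-- Receiver-1 successive-cancellation region for layer order λ = 3:
`T1 → S1 → U → S2 → S3 → T2`. -/
def R1L3 (fx : 𝒮 → 𝒯 → 𝒳) (fw : 𝒰 → 𝒱 → 𝒲) (s : HKSplit 𝒮 𝒯 𝒰 𝒱) (pU : 𝒰 → ℝ)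
    (ch : 𝒳 → 𝒲 → 𝒴₁ → 𝒴₂ → ℝ) : Set (ℝ × ℝ × ℝ × ℝ) :=
  {r | 0 ≤ r.1 ∧ 0 ≤ r.2.1 ∧ 0 ≤ r.2.2.1 ∧ 0 ≤ r.2.2.2 ∧
    r.1 ≤ cmiOf (hkJoint fx fw s pU ch) (fun ω => ω.1) (fun ω => ω.2.2.2.2.2.2.2.2.1) (fun ω => (ω.2.2.2.1))
        + cmiOf (hkJoint fx fw s pU ch) (fun ω => ω.2.1) (fun ω => ω.2.2.2.2.2.2.2.2.1) (fun ω => (ω.2.2.2.1, ω.1, ω.2.2.2.2.2.1))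
        + cmiOf (hkJoint fx fw s pU ch) (fun ω => ω.2.2.1) (fun ω => ω.2.2.2.2.2.2.2.2.1) (fun ω => (ω.2.2.2.1, ω.1, ω.2.2.2.2.2.1, ω.2.1)) ∧
    r.2.1 ≤ miOf (hkJoint fx fw s pU ch) (fun ω => ω.2.2.2.1) (fun ω => ω.2.2.2.2.2.2.2.2.1)
        + cmiOf (hkJoint fx fw s pU ch) (fun ω => ω.2.2.2.2.1) (fun ω => ω.2.2.2.2.2.2.2.2.1) (fun ω => (ω.2.2.2.1, ω.1, ω.2.2.2.2.2.1, ω.2.1, ω.2.2.1)) ∧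
    r.2.2.1 ≤ cmiOf (hkJoint fx fw s pU ch) (fun ω => ω.2.2.2.2.2.1) (fun ω => ω.2.2.2.2.2.2.2.2.1) (fun ω => (ω.2.2.2.1, ω.1))}

/-- Receiver-1 successive-cancellation region for layer order λ = 4:
`S1 → S2 → T1 → S3 → U → T2`. -/
def R1L4 (fx : 𝒮 → 𝒯 → 𝒳) (fw : 𝒰 → 𝒱 → 𝒲) (s : HKSplit 𝒮 𝒯 𝒰 𝒱) (pU : 𝒰 → ℝ)
    (ch : 𝒳 → 𝒲 → 𝒴₁ → 𝒴₂ → ℝ) : Set (ℝ × ℝ × ℝ × ℝ) :=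
  {r | 0 ≤ r.1 ∧ 0 ≤ r.2.1 ∧ 0 ≤ r.2.2.1 ∧ 0 ≤ r.2.2.2 ∧
    r.1 ≤ miOf (hkJoint fx fw s pU ch) (fun ω => ω.1) (fun ω => ω.2.2.2.2.2.2.2.2.1)
        + cmiOf (hkJoint fx fw s pU ch) (fun ω => ω.2.1) (fun ω => ω.2.2.2.2.2.2.2.2.1) (fun ω => (ω.1))
        + cmiOf (hkJoint fx fw s pU ch) (fun ω => ω.2.2.1) (fun ω => ω.2.2.2.2.2.2.2.2.1) (fun ω => (ω.1, ω.2.1, ω.2.2.2.1)) ∧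
    r.2.1 ≤ cmiOf (hkJoint fx fw s pU ch) (fun ω => ω.2.2.2.1) (fun ω => ω.2.2.2.2.2.2.2.2.1) (fun ω => (ω.1, ω.2.1))
        + cmiOf (hkJoint fx fw s pU ch) (fun ω => ω.2.2.2.2.1) (fun ω => ω.2.2.2.2.2.2.2.2.1) (fun ω => (ω.1, ω.2.1, ω.2.2.2.1, ω.2.2.1, ω.2.2.2.2.2.1)) ∧
    r.2.2.1 ≤ cmiOf (hkJoint fx fw s pU ch) (fun ω => ω.2.2.2.2.2.1) (fun ω => ω.2.2.2.2.2.2.2.2.1) (fun ω => (ω.1, ω.2.1, ω.2.2.2.1, ω.2.2.1))}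

/-- Receiver-1 successive-cancellation region for layer order λ = 5:
`T1 → U → S1 → S2 → T2 → S3`. -/
def R1L5 (fx : 𝒮 → 𝒯 → 𝒳) (fw : 𝒰 → 𝒱 → 𝒲) (s : HKSplit 𝒮 𝒯 𝒰 𝒱) (pU : 𝒰 → ℝ)
    (ch : 𝒳 → 𝒲 → 𝒴₁ → 𝒴₂ → ℝ) : Set (ℝ × ℝ × ℝ × ℝ) :=
  {r | 0 ≤ r.1 ∧ 0 ≤ r.2.1 ∧ 0 ≤ r.2.2.1 ∧ 0 ≤ r.2.2.2 ∧
    r.1 ≤ cmiOf (hkJoint fx fw s pU ch) (fun ω => ω.1) (fun ω => ω.2.2.2.2.2.2.2.2.1) (fun ω => (ω.2.2.2.1, ω.2.2.2.2.2.1))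
        + cmiOf (hkJoint fx fw s pU ch) (fun ω => ω.2.1) (fun ω => ω.2.2.2.2.2.2.2.2.1) (fun ω => (ω.2.2.2.1, ω.2.2.2.2.2.1, ω.1))
        + cmiOf (hkJoint fx fw s pU ch) (fun ω => ω.2.2.1) (fun ω => ω.2.2.2.2.2.2.2.2.1) (fun ω => (ω.2.2.2.1, ω.2.2.2.2.2.1, ω.1, ω.2.1, ω.2.2.2.2.1)) ∧
    r.2.1 ≤ miOf (hkJoint fx fw s pU ch) (fun ω => ω.2.2.2.1) (fun ω => ω.2.2.2.2.2.2.2.2.1)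
        + cmiOf (hkJoint fx fw s pU ch) (fun ω => ω.2.2.2.2.1) (fun ω => ω.2.2.2.2.2.2.2.2.1) (fun ω => (ω.2.2.2.1, ω.2.2.2.2.2.1, ω.1, ω.2.1)) ∧
    r.2.2.1 ≤ cmiOf (hkJoint fx fw s pU ch) (fun ω => ω.2.2.2.2.2.1) (fun ω => ω.2.2.2.2.2.2.2.2.1) (fun ω => (ω.2.2.2.1))}

/-- Receiver-1 successive-cancellation region for layer order λ = 6:
`T1 → S1 → S2 → U → S3 → T2`. -/
def R1L6 (fx : 𝒮 → 𝒯 → 𝒳) (fw : 𝒰 → 𝒱 → 𝒲) (s : HKSplit 𝒮 𝒯 𝒰 𝒱) (pU : 𝒰 → ℝ)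
    (ch : 𝒳 → 𝒲 → 𝒴₁ → 𝒴₂ → ℝ) : Set (ℝ × ℝ × ℝ × ℝ) :=
  {r | 0 ≤ r.1 ∧ 0 ≤ r.2.1 ∧ 0 ≤ r.2.2.1 ∧ 0 ≤ r.2.2.2 ∧
    r.1 ≤ cmiOf (hkJoint fx fw s pU ch) (fun ω => ω.1) (fun ω => ω.2.2.2.2.2.2.2.2.1) (fun ω => (ω.2.2.2.1))
        + cmiOf (hkJoint fx fw s pU ch) (fun ω => ω.2.1) (fun ω => ω.2.2.2.2.2.2.2.2.1) (fun ω => (ω.2.2.2.1, ω.1))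
        + cmiOf (hkJoint fx fw s pU ch) (fun ω => ω.2.2.1) (fun ω => ω.2.2.2.2.2.2.2.2.1) (fun ω => (ω.2.2.2.1, ω.1, ω.2.1, ω.2.2.2.2.2.1)) ∧
    r.2.1 ≤ miOf (hkJoint fx fw s pU ch) (fun ω => ω.2.2.2.1) (fun ω => ω.2.2.2.2.2.2.2.2.1)
        + cmiOf (hkJoint fx fw s pU ch) (fun ω => ω.2.2.2.2.1) (fun ω => ω.2.2.2.2.2.2.2.2.1) (fun ω => (ω.2.2.2.1, ω.1, ω.2.1, ω.2.2.2.2.2.1, ω.2.2.1)) ∧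
    r.2.2.1 ≤ cmiOf (hkJoint fx fw s pU ch) (fun ω => ω.2.2.2.2.2.1) (fun ω => ω.2.2.2.2.2.2.2.2.1) (fun ω => (ω.2.2.2.1, ω.1, ω.2.1))}

/-- Receiver-2 successive-cancellation region for layer order λ = 7:
`S1 → V1 → S2 → S3 → U → V2`. -/
def R2L7 (fx : 𝒮 → 𝒯 → 𝒳) (fw : 𝒰 → 𝒱 → 𝒲) (s : HKSplit 𝒮 𝒯 𝒰 𝒱) (pU : 𝒰 → ℝ)
    (ch : 𝒳 → 𝒲 → 𝒴₁ → 𝒴₂ → ℝ) : Set (ℝ × ℝ × ℝ × ℝ) :=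
  {r | 0 ≤ r.1 ∧ 0 ≤ r.2.1 ∧ 0 ≤ r.2.2.1 ∧ 0 ≤ r.2.2.2 ∧
    r.1 ≤ miOf (hkJoint fx fw s pU ch) (fun ω => ω.1) (fun ω => ω.2.2.2.2.2.2.2.2.2)
        + cmiOf (hkJoint fx fw s pU ch) (fun ω => ω.2.1) (fun ω => ω.2.2.2.2.2.2.2.2.2) (fun ω => (ω.1, ω.2.2.2.2.2.2.1))
        + cmiOf (hkJoint fx fw s pU ch) (fun ω => ω.2.2.1) (fun ω => ω.2.2.2.2.2.2.2.2.2) (fun ω => (ω.1, ω.2.2.2.2.2.2.1, ω.2.1)) ∧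
    r.2.2.2 ≤ cmiOf (hkJoint fx fw s pU ch) (fun ω => ω.2.2.2.2.2.2.1) (fun ω => ω.2.2.2.2.2.2.2.2.2) (fun ω => (ω.1))
        + cmiOf (hkJoint fx fw s pU ch) (fun ω => ω.2.2.2.2.2.2.2.1) (fun ω => ω.2.2.2.2.2.2.2.2.2) (fun ω => (ω.1, ω.2.2.2.2.2.2.1, ω.2.1, ω.2.2.1, ω.2.2.2.2.2.1)) ∧
    r.2.2.1 ≤ cmiOf (hkJoint fx fw s pU ch) (fun ω => ω.2.2.2.2.2.1) (fun ω => ω.2.2.2.2.2.2.2.2.2) (fun ω => (ω.1, ω.2.2.2.2.2.2.1, ω.2.1, ω.2.2.1))}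

/-- Receiver-2 successive-cancellation region for layer order λ = 8:
`V1 → U → S1 → V2 → S2 → S3`. -/
def R2L8 (fx : 𝒮 → 𝒯 → 𝒳) (fw : 𝒰 → 𝒱 → 𝒲) (s : HKSplit 𝒮 𝒯 𝒰 𝒱) (pU : 𝒰 → ℝ)
    (ch : 𝒳 → 𝒲 → 𝒴₁ → 𝒴₂ → ℝ) : Set (ℝ × ℝ × ℝ × ℝ) :=
  {r | 0 ≤ r.1 ∧ 0 ≤ r.2.1 ∧ 0 ≤ r.2.2.1 ∧ 0 ≤ r.2.2.2 ∧
    r.1 ≤ cmiOf (hkJoint fx fw s pU ch) (fun ω => ω.1) (fun ω => ω.2.2.2.2.2.2.2.2.2) (fun ω => (ω.2.2.2.2.2.2.1, ω.2.2.2.2.2.1))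
        + cmiOf (hkJoint fx fw s pU ch) (fun ω => ω.2.1) (fun ω => ω.2.2.2.2.2.2.2.2.2) (fun ω => (ω.2.2.2.2.2.2.1, ω.2.2.2.2.2.1, ω.1, ω.2.2.2.2.2.2.2.1))
        + cmiOf (hkJoint fx fw s pU ch) (fun ω => ω.2.2.1) (fun ω => ω.2.2.2.2.2.2.2.2.2) (fun ω => (ω.2.2.2.2.2.2.1, ω.2.2.2.2.2.1, ω.1, ω.2.2.2.2.2.2.2.1, ω.2.1)) ∧
    r.2.2.2 ≤ miOf (hkJoint fx fw s pU ch) (fun ω => ω.2.2.2.2.2.2.1) (fun ω => ω.2.2.2.2.2.2.2.2.2)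
        + cmiOf (hkJoint fx fw s pU ch) (fun ω => ω.2.2.2.2.2.2.2.1) (fun ω => ω.2.2.2.2.2.2.2.2.2) (fun ω => (ω.2.2.2.2.2.2.1, ω.2.2.2.2.2.1, ω.1)) ∧
    r.2.2.1 ≤ cmiOf (hkJoint fx fw s pU ch) (fun ω => ω.2.2.2.2.2.1) (fun ω => ω.2.2.2.2.2.2.2.2.2) (fun ω => (ω.2.2.2.2.2.2.1))}

/-- Receiver-2 successive-cancellation region for layer order λ = 9:
`V1 → S1 → U → S2 → S3 → V2`. -/
def R2L9 (fx : 𝒮 → 𝒯 → 𝒳) (fw : 𝒰 → 𝒱 → 𝒲) (s : HKSplit 𝒮 𝒯 𝒰 𝒱) (pU : 𝒰 → ℝ)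
    (ch : 𝒳 → 𝒲 → 𝒴₁ → 𝒴₂ → ℝ) : Set (ℝ × ℝ × ℝ × ℝ) :=
  {r | 0 ≤ r.1 ∧ 0 ≤ r.2.1 ∧ 0 ≤ r.2.2.1 ∧ 0 ≤ r.2.2.2 ∧
    r.1 ≤ cmiOf (hkJoint fx fw s pU ch) (fun ω => ω.1) (fun ω => ω.2.2.2.2.2.2.2.2.2) (fun ω => (ω.2.2.2.2.2.2.1))
        + cmiOf (hkJoint fx fw s pU ch) (fun ω => ω.2.1) (fun ω => ω.2.2.2.2.2.2.2.2.2) (fun ω => (ω.2.2.2.2.2.2.1, ω.1, ω.2.2.2.2.2.1))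
        + cmiOf (hkJoint fx fw s pU ch) (fun ω => ω.2.2.1) (fun ω => ω.2.2.2.2.2.2.2.2.2) (fun ω => (ω.2.2.2.2.2.2.1, ω.1, ω.2.2.2.2.2.1, ω.2.1)) ∧
    r.2.2.2 ≤ miOf (hkJoint fx fw s pU ch) (fun ω => ω.2.2.2.2.2.2.1) (fun ω => ω.2.2.2.2.2.2.2.2.2)
        + cmiOf (hkJoint fx fw s pU ch) (fun ω => ω.2.2.2.2.2.2.2.1) (fun ω => ω.2.2.2.2.2.2.2.2.2) (fun ω => (ω.2.2.2.2.2.2.1, ω.1, ω.2.2.2.2.2.1, ω.2.1, ω.2.2.1)) ∧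
    r.2.2.1 ≤ cmiOf (hkJoint fx fw s pU ch) (fun ω => ω.2.2.2.2.2.1) (fun ω => ω.2.2.2.2.2.2.2.2.2) (fun ω => (ω.2.2.2.2.2.2.1, ω.1))}

/-- Receiver-2 successive-cancellation region for layer order λ = 10:
`S1 → S2 → V1 → S3 → U → V2`. -/
def R2L10 (fx : 𝒮 → 𝒯 → 𝒳) (fw : 𝒰 → 𝒱 → 𝒲) (s : HKSplit 𝒮 𝒯 𝒰 𝒱) (pU : 𝒰 → ℝ)
    (ch : 𝒳 → 𝒲 → 𝒴₁ → 𝒴₂ → ℝ) : Set (ℝ × ℝ × ℝ × ℝ) :=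
  {r | 0 ≤ r.1 ∧ 0 ≤ r.2.1 ∧ 0 ≤ r.2.2.1 ∧ 0 ≤ r.2.2.2 ∧
    r.1 ≤ miOf (hkJoint fx fw s pU ch) (fun ω => ω.1) (fun ω => ω.2.2.2.2.2.2.2.2.2)
        + cmiOf (hkJoint fx fw s pU ch) (fun ω => ω.2.1) (fun ω => ω.2.2.2.2.2.2.2.2.2) (fun ω => (ω.1))
        + cmiOf (hkJoint fx fw s pU ch) (fun ω => ω.2.2.1) (fun ω => ω.2.2.2.2.2.2.2.2.2) (fun ω => (ω.1, ω.2.1, ω.2.2.2.2.2.2.1)) ∧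
    r.2.2.2 ≤ cmiOf (hkJoint fx fw s pU ch) (fun ω => ω.2.2.2.2.2.2.1) (fun ω => ω.2.2.2.2.2.2.2.2.2) (fun ω => (ω.1, ω.2.1))
        + cmiOf (hkJoint fx fw s pU ch) (fun ω => ω.2.2.2.2.2.2.2.1) (fun ω => ω.2.2.2.2.2.2.2.2.2) (fun ω => (ω.1, ω.2.1, ω.2.2.2.2.2.2.1, ω.2.2.1, ω.2.2.2.2.2.1)) ∧
    r.2.2.1 ≤ cmiOf (hkJoint fx fw s pU ch) (fun ω => ω.2.2.2.2.2.1) (fun ω => ω.2.2.2.2.2.2.2.2.2) (fun ω => (ω.1, ω.2.1, ω.2.2.2.2.2.2.1, ω.2.2.1))}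

/-- Receiver-2 successive-cancellation region for layer order λ = 11:
`V1 → U → S1 → S2 → V2 → S3`. -/
def R2L11 (fx : 𝒮 → 𝒯 → 𝒳) (fw : 𝒰 → 𝒱 → 𝒲) (s : HKSplit 𝒮 𝒯 𝒰 𝒱) (pU : 𝒰 → ℝ)
    (ch : 𝒳 → 𝒲 → 𝒴₁ → 𝒴₂ → ℝ) : Set (ℝ × ℝ × ℝ × ℝ) :=
  {r | 0 ≤ r.1 ∧ 0 ≤ r.2.1 ∧ 0 ≤ r.2.2.1 ∧ 0 ≤ r.2.2.2 ∧
    r.1 ≤ cmiOf (hkJoint fx fw s pU ch) (fun ω => ω.1) (fun ω => ω.2.2.2.2.2.2.2.2.2) (fun ω => (ω.2.2.2.2.2.2.1, ω.2.2.2.2.2.1))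
        + cmiOf (hkJoint fx fw s pU ch) (fun ω => ω.2.1) (fun ω => ω.2.2.2.2.2.2.2.2.2) (fun ω => (ω.2.2.2.2.2.2.1, ω.2.2.2.2.2.1, ω.1))
        + cmiOf (hkJoint fx fw s pU ch) (fun ω => ω.2.2.1) (fun ω => ω.2.2.2.2.2.2.2.2.2) (fun ω => (ω.2.2.2.2.2.2.1, ω.2.2.2.2.2.1, ω.1, ω.2.1, ω.2.2.2.2.2.2.2.1)) ∧
    r.2.2.2 ≤ miOf (hkJoint fx fw s pU ch) (fun ω => ω.2.2.2.2.2.2.1) (fun ω => ω.2.2.2.2.2.2.2.2.2)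
        + cmiOf (hkJoint fx fw s pU ch) (fun ω => ω.2.2.2.2.2.2.2.1) (fun ω => ω.2.2.2.2.2.2.2.2.2) (fun ω => (ω.2.2.2.2.2.2.1, ω.2.2.2.2.2.1, ω.1, ω.2.1)) ∧
    r.2.2.1 ≤ cmiOf (hkJoint fx fw s pU ch) (fun ω => ω.2.2.2.2.2.1) (fun ω => ω.2.2.2.2.2.2.2.2.2) (fun ω => (ω.2.2.2.2.2.2.1))}

/-- Receiver-2 successive-cancellation region for layer order λ = 12:
`V1 → S1 → S2 → U → S3 → V2`. -/
def R2L12 (fx : 𝒮 → 𝒯 → 𝒳) (fw : 𝒰 → 𝒱 → 𝒲) (s : HKSplit 𝒮 𝒯 𝒰 𝒱) (pU : 𝒰 → ℝ)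
    (ch : 𝒳 → 𝒲 → 𝒴₁ → 𝒴₂ → ℝ) : Set (ℝ × ℝ × ℝ × ℝ) :=
  {r | 0 ≤ r.1 ∧ 0 ≤ r.2.1 ∧ 0 ≤ r.2.2.1 ∧ 0 ≤ r.2.2.2 ∧
    r.1 ≤ cmiOf (hkJoint fx fw s pU ch) (fun ω => ω.1) (fun ω => ω.2.2.2.2.2.2.2.2.2) (fun ω => (ω.2.2.2.2.2.2.1))
        + cmiOf (hkJoint fx fw s pU ch) (fun ω => ω.2.1) (fun ω => ω.2.2.2.2.2.2.2.2.2) (fun ω => (ω.2.2.2.2.2.2.1, ω.1))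
        + cmiOf (hkJoint fx fw s pU ch) (fun ω => ω.2.2.1) (fun ω => ω.2.2.2.2.2.2.2.2.2) (fun ω => (ω.2.2.2.2.2.2.1, ω.1, ω.2.1, ω.2.2.2.2.2.1)) ∧
    r.2.2.2 ≤ miOf (hkJoint fx fw s pU ch) (fun ω => ω.2.2.2.2.2.2.1) (fun ω => ω.2.2.2.2.2.2.2.2.2)
        + cmiOf (hkJoint fx fw s pU ch) (fun ω => ω.2.2.2.2.2.2.2.1) (fun ω => ω.2.2.2.2.2.2.2.2.2) (fun ω => (ω.2.2.2.2.2.2.1, ω.1, ω.2.1, ω.2.2.2.2.2.1, ω.2.2.1)) ∧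
    r.2.2.1 ≤ cmiOf (hkJoint fx fw s pU ch) (fun ω => ω.2.2.2.2.2.1) (fun ω => ω.2.2.2.2.2.2.2.2.2) (fun ω => (ω.2.2.2.2.2.2.1, ω.1, ω.2.1))}

/-- The six layer orders at receiver 1 (λ₁ = 1,…,6). -/
inductive HKOrder1 | o1 | o2 | o3 | o4 | o5 | o6

/-- The six layer orders at receiver 2 (λ₂ = 7,…,12). -/
inductive HKOrder2 | o7 | o8 | o9 | o10 | o11 | o12

/-- `𝓡₁(p',λ₁)` for a layer order `λ₁` at receiver 1. -/
def R1Reg (fx : 𝒮 → 𝒯 → 𝒳) (fw : 𝒰 → 𝒱 → 𝒲) (s : HKSplit 𝒮 𝒯 𝒰 𝒱) (pU : 𝒰 → ℝ)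
    (ch : 𝒳 → 𝒲 → 𝒴₁ → 𝒴₂ → ℝ) : HKOrder1 → Set (ℝ × ℝ × ℝ × ℝ)
  | .o1 => R1L1 fx fw s pU ch
  | .o2 => R1L2 fx fw s pU ch
  | .o3 => R1L3 fx fw s pU ch
  | .o4 => R1L4 fx fw s pU ch
  | .o5 => R1L5 fx fw s pU ch
  | .o6 => R1L6 fx fw s pU ch

/-- `𝓡₂(p',λ₂)` for a layer order `λ₂` at receiver 2. -/
def R2Reg (fx : 𝒮 → 𝒯 → 𝒳) (fw : 𝒰 → 𝒱 → 𝒲) (s : HKSplit 𝒮 𝒯 𝒰 𝒱) (pU : 𝒰 → ℝ)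
    (ch : 𝒳 → 𝒲 → 𝒴₁ → 𝒴₂ → ℝ) : HKOrder2 → Set (ℝ × ℝ × ℝ × ℝ)
  | .o7 => R2L7 fx fw s pU ch
  | .o8 => R2L8 fx fw s pU ch
  | .o9 => R2L9 fx fw s pU ch
  | .o10 => R2L10 fx fw s pU ch
  | .o11 => R2L11 fx fw s pU ch
  | .o12 => R2L12 fx fw s pU ch

/-- Mass of the `r`-class of `ω` under the weight `q`. -/
def classMass {Ω : Type*} [Fintype Ω] (q : Ω → ℝ) (r : Ω → Ω → Prop) (ω : Ω) : ℝ :=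
  ∑ ω', if r ω ω' then q ω' else 0

/-- Entropy of the partition of `Ω` into the classes of the relation `r`, under the weight `q`. -/
def relEnt {Ω : Type*} [Fintype Ω] (q : Ω → ℝ) (r : Ω → Ω → Prop) : ℝ :=
  -∑ ω, q ω * Real.log (classMass q r ω)

lemma Hof_eq_relEnt {Ω β : Type*} [Fintype Ω] [Fintype β] (q : Ω → ℝ) (A : Ω → β) :
    Hof q A = relEnt q (fun ω ω' => A ω = A ω') := by
  have key (b : β) : pushf q A b * Real.log (pushf q A b)
      = ∑ ω, if A ω = b then q ω * Real.log (pushf q A (A ω)) else 0 := by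
    conv_lhs => rw [pushf]
    rw [Finset.sum_mul]
    refine Finset.sum_congr rfl fun ω _ => ?_
    split_ifs with h
    · rw [h]
      rfl
    · simp
  unfold Hof ent relEnt
  rw [Finset.sum_congr rfl fun b _ => key b, Finset.sum_comm]
  congr 1
  refine Finset.sum_congr rfl fun ω _ => ?_
  simp [pushf, classMass, eq_comm]

lemma relEnt_congr {Ω : Type*} [Fintype Ω] (q : Ω → ℝ) {r r' : Ω → Ω → Prop}
    (h : ∀ ω ω', r ω ω' ↔ r' ω ω') : relEnt q r = relEnt q r' := by
  have : r = r' := by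
    funext ω ω'
    exact propext (h ω ω')
  rw [this]

lemma relEnt_of_total {Ω : Type*} [Fintype Ω] {q : Ω → ℝ} (hq : ∑ ω, q ω = 1)
    {r : Ω → Ω → Prop} (h : ∀ ω ω', r ω ω') : relEnt q r = 0 := by
  simp [relEnt, classMass, h, hq]

lemma relEnt_equiv {Ω Ω' : Type*} [Fintype Ω] [Fintype Ω'] (e : Ω ≃ Ω') (q : Ω → ℝ)
    (r : Ω → Ω → Prop) :
    relEnt q r = relEnt (fun x => q (e.symm x)) (fun x x' => r (e.symm x) (e.symm x')) := by
  unfold relEnt classMass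
  congr 1
  rw [← e.symm.sum_comp]
  refine Finset.sum_congr rfl fun ω _ => ?_
  rw [← e.symm.sum_comp (fun ω' => if r _ ω' then q ω' else 0)]

lemma relEnt_marginal {Ω Z : Type*} [Fintype Ω] [Fintype Z] (q : Ω × Z → ℝ)
    (r : Ω → Ω → Prop) :
    relEnt q (fun x x' => r x.1 x'.1) = relEnt (fun ω => ∑ z, q (ω, z)) r := by
  have hm (x : Ω × Z) : classMass q (fun x x' => r x.1 x'.1) x
      = classMass (fun ω => ∑ z, q (ω, z)) r x.1 := by
    unfold classMass
    rw [Fintype.sum_prod_type]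
    refine Finset.sum_congr rfl fun ω _ => ?_
    by_cases h : r x.1 ω <;> simp [h]
  unfold relEnt
  simp_rw [hm, Fintype.sum_prod_type, Finset.sum_mul]

lemma le_classMass {Ω : Type*} [Fintype Ω] {q : Ω → ℝ} (hq : ∀ ω, 0 ≤ q ω)
    {r : Ω → Ω → Prop} {ω ω' : Ω} (h : r ω ω') : q ω' ≤ classMass q r ω := by
  have := Finset.single_le_sum (f := fun ω' => if r ω ω' then q ω' else 0)
    (fun i _ => by split_ifs <;> simp [hq]) (Finset.mem_univ ω')
  simpa [h, classMass] using this

lemma classMass_nonneg {Ω : Type*} [Fintype Ω] {q : Ω → ℝ} (hq : ∀ ω, 0 ≤ q ω)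
    (r : Ω → Ω → Prop) (ω : Ω) : 0 ≤ classMass q r ω :=
  Finset.sum_nonneg fun i _ => by split_ifs <;> simp [hq]

lemma classMass_eq_of_rel {Ω : Type*} [Fintype Ω] (q : Ω → ℝ) {r : Ω → Ω → Prop}
    (hr : Equivalence r) {ω ω' : Ω} (h : r ω ω') : classMass q r ω = classMass q r ω' := by
  unfold classMass
  refine Finset.sum_congr rfl fun x _ => ?_
  have : r ω x ↔ r ω' x := ⟨fun hx => hr.trans (hr.symm h) hx, fun hx => hr.trans h hx⟩
  simp [this]

lemma relEnt_prod {Ω Z : Type*} [Fintype Ω] [Fintype Z] {p : Ω → ℝ} {p' : Z → ℝ}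
    (hp : IsPMF p) (hp' : IsPMF p') {r : Ω → Ω → Prop} {r' : Z → Z → Prop}
    (hr : ∀ x, r x x) (hr' : ∀ x, r' x x) :
    relEnt (fun x : Ω × Z => p x.1 * p' x.2) (fun x x' => r x.1 x'.1 ∧ r' x.2 x'.2)
      = relEnt p r + relEnt p' r' := by
  have hm (x : Ω × Z) :
      classMass (fun x : Ω × Z => p x.1 * p' x.2) (fun x x' => r x.1 x'.1 ∧ r' x.2 x'.2) x
        = classMass p r x.1 * classMass p' r' x.2 := by
    unfold classMass
    rw [Fintype.sum_prod_type, Finset.sum_mul_sum]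
    refine Finset.sum_congr rfl fun a _ => Finset.sum_congr rfl fun b _ => ?_
    by_cases h : r x.1 a <;> by_cases h' : r' x.2 b <;> simp [h, h']
  have ht (a : Ω) (b : Z) : p a * p' b * Real.log (classMass p r a * classMass p' r' b)
      = p a * Real.log (classMass p r a) * p' b + p a * (p' b * Real.log (classMass p' r' b)) := by
    rcases (hp.1 a).eq_or_lt with h | h
    · simp [← h]
    rcases (hp'.1 b).eq_or_lt with h' | h'
    · simp [← h']
    rw [Real.log_mul (h.trans_le (le_classMass hp.1 (hr a))).ne'
      (h'.trans_le (le_classMass hp'.1 (hr' b))).ne']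
    ring
  unfold relEnt
  simp_rw [hm, Fintype.sum_prod_type, ht, Finset.sum_add_distrib, ← Finset.mul_sum,
    ← Finset.sum_mul, hp.2, hp'.2]
  ring

/-- Submodularity of entropy, for partitions. -/
lemma relEnt_submodular {Ω : Type*} [Fintype Ω] {q : Ω → ℝ} (hq : ∀ ω, 0 ≤ q ω)
    {a b c : Ω → Ω → Prop} (ha : Equivalence a) (hb : Equivalence b) (hc : Equivalence c)
    (hac : ∀ x y, a x y → c x y) (hbc : ∀ x y, b x y → c x y) :
    relEnt q (fun x y => a x y ∧ b x y) + relEnt q c ≤ relEnt q a + relEnt q b := by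
  have hde : Equivalence fun x y => a x y ∧ b x y :=
    ⟨fun x => ⟨ha.refl x, hb.refl x⟩, fun h => ⟨ha.symm h.1, hb.symm h.2⟩,
      fun h h' => ⟨ha.trans h.1 h'.1, hb.trans h.2 h'.2⟩⟩
  have hd (x y : Ω) : (fun x y => a x y ∧ b x y) x y ↔ a x y ∧ b x y := Iff.rfl
  generalize (fun x y => a x y ∧ b x y) = d at hd hde ⊢
  have nn := classMass_nonneg hq
  have term (ω : Ω) : q ω - q ω * (classMass q a ω * classMass q b ω /
        (classMass q d ω * classMass q c ω))
      ≤ q ω * Real.log (classMass q d ω) + q ω * Real.log (classMass q c ω)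
        - q ω * Real.log (classMass q a ω) - q ω * Real.log (classMass q b ω) := by
    rcases (hq ω).eq_or_lt with h | h
    · simp [← h]
    have pa := h.trans_le (le_classMass hq (ha.refl ω))
    have pb := h.trans_le (le_classMass hq (hb.refl ω))
    have pc := h.trans_le (le_classMass hq (hc.refl ω))
    have pd := h.trans_le (le_classMass hq (hde.refl ω))
    have := Real.log_le_sub_one_of_pos (div_pos (mul_pos pa pb) (mul_pos pd pc))
    rw [Real.log_div (mul_pos pa pb).ne' (mul_pos pd pc).ne', Real.log_mul pa.ne' pb.ne',
      Real.log_mul pd.ne' pc.ne'] at this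
    nlinarith
  have bound : ∑ ω, q ω * (classMass q a ω * classMass q b ω /
      (classMass q d ω * classMass q c ω)) ≤ ∑ ω, q ω := by
    have inner (x y : Ω) : (∑ ω, if a ω x ∧ b ω y then
        q ω / (classMass q d ω * classMass q c ω) else 0)
        ≤ if c x y then (classMass q c x)⁻¹ else 0 := by
      by_cases hne : ∃ ω₀, a ω₀ x ∧ b ω₀ y
      · obtain ⟨ω₀, h1, h2⟩ := hne
        have hcx : c ω₀ x := hac _ _ h1
        rw [if_pos (hc.trans (hc.symm hcx) (hbc _ _ h2))]
        have e1 (ω : Ω) : (if a ω x ∧ b ω y then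
            q ω / (classMass q d ω * classMass q c ω) else 0)
            = (if d ω₀ ω then q ω else 0) * ((classMass q d ω₀)⁻¹ * (classMass q c x)⁻¹) := by
          have hiff : (a ω x ∧ b ω y) ↔ d ω₀ ω :=
            ⟨fun h => (hd _ _).2 ⟨ha.trans h1 (ha.symm h.1), hb.trans h2 (hb.symm h.2)⟩,
              fun h => ⟨ha.trans (ha.symm ((hd _ _).1 h).1) h1,
                hb.trans (hb.symm ((hd _ _).1 h).2) h2⟩⟩
          by_cases h : d ω₀ ω
          · rw [if_pos (hiff.2 h), if_pos h, ← classMass_eq_of_rel q hde h,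
              ← classMass_eq_of_rel q hc (hc.trans (hc.symm hcx) (hac _ _ ((hd _ _).1 h).1)),
              div_eq_mul_inv, mul_inv]
          · rw [if_neg (fun h' => h (hiff.1 h')), if_neg h, zero_mul]
        rw [Finset.sum_congr rfl fun ω _ => e1 ω, ← Finset.sum_mul]
        change classMass q d ω₀ * _ ≤ _
        rw [← mul_assoc]
        exact mul_le_of_le_one_left (inv_nonneg.2 (nn c x)) mul_inv_le_one
      · rw [Finset.sum_eq_zero fun ω _ => if_neg fun h => hne ⟨ω, h⟩]
        split_ifs
        · exact inv_nonneg.2 (nn c x)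
        · exact le_rfl
    calc ∑ ω, q ω * (classMass q a ω * classMass q b ω / (classMass q d ω * classMass q c ω))
        = ∑ x, ∑ y, q x * q y * ∑ ω, (if a ω x ∧ b ω y then
            q ω / (classMass q d ω * classMass q c ω) else 0) := by
          have e (ω : Ω) : q ω * (classMass q a ω * classMass q b ω /
              (classMass q d ω * classMass q c ω)) = ∑ x, ∑ y, q x * q y *
              (if a ω x ∧ b ω y then q ω / (classMass q d ω * classMass q c ω) else 0) := by
            rw [mul_div_left_comm]
            conv_lhs => rw [show classMass q a ω = ∑ x, if a ω x then q x else 0 from rfl,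
              show classMass q b ω = ∑ x, if b ω x then q x else 0 from rfl]
            rw [Finset.sum_mul_sum, Finset.sum_mul]
            refine Finset.sum_congr rfl fun x _ => ?_
            rw [Finset.sum_mul]
            refine Finset.sum_congr rfl fun y _ => ?_
            by_cases h : a ω x <;> by_cases h' : b ω y <;> simp [h, h']
          rw [Finset.sum_congr rfl fun ω _ => e ω, Finset.sum_comm]
          refine Finset.sum_congr rfl fun x _ => ?_
          rw [Finset.sum_comm]
          refine Finset.sum_congr rfl fun y _ => ?_
          rw [Finset.mul_sum]
      _ ≤ ∑ x, ∑ y, q x * q y * (if c x y then (classMass q c x)⁻¹ else 0) :=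
          Finset.sum_le_sum fun x _ => Finset.sum_le_sum fun y _ =>
            mul_le_mul_of_nonneg_left (inner x y) (mul_nonneg (hq x) (hq y))
      _ = ∑ x, q x * (classMass q c x * (classMass q c x)⁻¹) := by
          refine Finset.sum_congr rfl fun x _ => ?_
          conv_rhs => rw [show classMass q c x = ∑ y, if c x y then q y else 0 from rfl]
          rw [Finset.sum_mul, Finset.mul_sum]
          refine Finset.sum_congr rfl fun y _ => ?_
          by_cases h : c x y
          · simp [h, classMass, mul_assoc]
          · simp [h]
      _ ≤ ∑ x, q x := Finset.sum_le_sum fun x _ =>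
          mul_le_of_le_one_right (hq x) mul_inv_le_one
  have := Finset.sum_le_sum fun ω (_ : ω ∈ Finset.univ) => term ω
  simp only [Finset.sum_sub_distrib, Finset.sum_add_distrib] at this
  unfold relEnt
  linarith

/-- Under the law `P`, observing the `r`-class of `x` reveals `g x` completely with
probability `ε`, and otherwise leaves it distributed as `p`. -/
def Reveals {Ω α : Type*} [Fintype Ω] [Fintype α] (P : Ω → ℝ) (g : Ω → α) (p : α → ℝ)
    (r : Ω → Ω → Prop) (ε : ℝ) : Prop :=
  ∃ R : Ω → Prop, (∀ x, R x → ∀ x', r x x' → g x' = g x) ∧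
    (∀ x, ¬ R x → ∀ k : α → ℝ, (∑ x', if r x x' then P x' * k (g x') else 0)
      = classMass P r x * ∑ a, p a * k a) ∧
    (∀ k : α → ℝ, (∑ x, if R x then P x * k (g x) else 0) = ε * ∑ a, p a * k a) ∧
    ∀ k : α → ℝ, ∑ x, P x * k (g x) = ∑ a, p a * k a

lemma relEnt_split {Ω α Z : Type*} [Fintype Ω] [Fintype α] [Fintype Z]
    {P : Ω → ℝ} {g : Ω → α} {p : α → ℝ} {r : Ω → Ω → Prop} {ε : ℝ} (h : Reveals P g p r ε)
    (hP : ∀ x, 0 ≤ P x) (hr : ∀ x, r x x) {V : α → Z → ℝ} (hV : ∀ a, IsPMF (V a))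
    {r' : Z → Z → Prop} (hr' : ∀ z, r' z z) :
    relEnt (fun x : Ω × Z => P x.1 * V (g x.1) x.2) (fun x x' => r x.1 x'.1 ∧ r' x.2 x'.2)
      = relEnt P r
        - ε * ∑ a, p a * ∑ z, V a z * Real.log (classMass (V a) r' z)
        - (1 - ε) * ∑ a, p a * ∑ z, V a z * Real.log (∑ b, p b * classMass (V b) r' z) := by
  obtain ⟨R, hR, hN, hε, hp⟩ := h
  set Q := classMass (fun x : Ω × Z => P x.1 * V (g x.1) x.2)
    (fun x x' => r x.1 x'.1 ∧ r' x.2 x'.2) with hQ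
  have hQ0 (x : Ω) (z : Z) : Q (x, z)
      = ∑ x', if r x x' then P x' * classMass (V (g x')) r' z else 0 := by
    rw [hQ]
    unfold classMass
    rw [Fintype.sum_prod_type]
    refine Finset.sum_congr rfl fun a _ => ?_
    by_cases h : r x a
    · simp only [h, true_and, if_true, Finset.mul_sum]
      refine Finset.sum_congr rfl fun b _ => ?_
      by_cases h' : r' z b <;> simp [h']
    · simp [h]
  have hQR (x : Ω) (hx : R x) (z : Z) :
      Q (x, z) = classMass P r x * classMass (V (g x)) r' z := by
    rw [hQ0, classMass, Finset.sum_mul]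
    refine Finset.sum_congr rfl fun a _ => ?_
    by_cases h : r x a
    · simp [h, hR x hx a h]
    · simp [h]
  have hQN (x : Ω) (hx : ¬ R x) (z : Z) :
      Q (x, z) = classMass P r x * ∑ b, p b * classMass (V b) r' z := by
    rw [hQ0, hN x hx (fun a => classMass (V a) r' z)]
  have term (x : Ω) (z : Z) : P x * V (g x) z * Real.log (Q (x, z))
      = P x * Real.log (classMass P r x) * V (g x) z
        + (if R x then P x * (V (g x) z * Real.log (classMass (V (g x)) r' z)) else 0)
        + (P x * (V (g x) z * Real.log (∑ b, p b * classMass (V b) r' z))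
          - if R x then P x * (V (g x) z * Real.log (∑ b, p b * classMass (V b) r' z))
            else 0) := by
    rcases (hP x).eq_or_lt with h | h
    · simp [← h]
    rcases ((hV (g x)).1 z).eq_or_lt with h' | h'
    · simp [← h']
    have hpos : 0 < Q (x, z) := (mul_pos h h').trans_le
      (le_classMass (q := fun x : Ω × Z => P x.1 * V (g x.1) x.2) (ω' := (x, z))
        (fun ω => mul_nonneg (hP _) ((hV _).1 _)) ⟨hr x, hr' z⟩)
    by_cases hx : R x
    · rw [hQR x hx] at hpos ⊢
      rw [Real.log_mul (left_ne_zero_of_mul hpos.ne') (right_ne_zero_of_mul hpos.ne')]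
      simp only [hx, if_true]
      ring
    · rw [hQN x hx] at hpos ⊢
      rw [Real.log_mul (left_ne_zero_of_mul hpos.ne') (right_ne_zero_of_mul hpos.ne')]
      simp only [hx, if_false]
      ring
  have ite_sum (k : α → Z → ℝ) (x : Ω) : (∑ z, if R x then P x * k (g x) z else 0)
      = if R x then P x * ∑ z, k (g x) z else 0 := by
    split_ifs <;> simp [Finset.mul_sum]
  have main : ∑ x : Ω × Z, P x.1 * V (g x.1) x.2 * Real.log (Q x)
      = ∑ x, P x * Real.log (classMass P r x)
        + ε * ∑ a, p a * ∑ z, V a z * Real.log (classMass (V a) r' z)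
        + (∑ a, p a * ∑ z, V a z * Real.log (∑ b, p b * classMass (V b) r' z)
          - ε * ∑ a, p a * ∑ z, V a z * Real.log (∑ b, p b * classMass (V b) r' z)) := by
    rw [Fintype.sum_prod_type]
    simp_rw [term, Finset.sum_add_distrib, Finset.sum_sub_distrib]
    simp_rw [ite_sum (fun a z => V a z * Real.log (classMass (V a) r' z)),
      ite_sum (fun a z => V a z * Real.log (∑ b, p b * classMass (V b) r' z)),
      ← Finset.mul_sum, (hV _).2, mul_one]
    rw [hε (fun a => ∑ z, V a z * Real.log (classMass (V a) r' z)),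
      hε (fun a => ∑ z, V a z * Real.log (∑ b, p b * classMass (V b) r' z)),
      hp (fun a => ∑ z, V a z * Real.log (∑ b, p b * classMass (V b) r' z))]
  rw [relEnt, main, relEnt]
  ring

/-- Agreement of two points, required only when `c` holds. -/
def agreeIf {α : Type*} (c : Prop) (x x' : α) : Prop := c → x = x'

lemma agreeIf_equivalence {α : Type*} (c : Prop) : Equivalence (agreeIf (α := α) c) :=
  ⟨fun _ _ => rfl, fun h hc => (h hc).symm, fun h h' hc => (h hc).trans (h' hc)⟩

lemma reveals_true {Ω α : Type*} [Fintype Ω] [Fintype α] {P : Ω → ℝ} {g : Ω → α} {p : α → ℝ}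
    {r : Ω → Ω → Prop} (hr : ∀ x x', r x x' → g x' = g x)
    (hp : ∀ k : α → ℝ, ∑ x, P x * k (g x) = ∑ a, p a * k a) : Reveals P g p r 1 :=
  ⟨fun _ => True, fun x _ x' h => hr x x' h, fun _ h => (h trivial).elim,
    fun k => by simp [hp], hp⟩

lemma reveals_false {Ω α : Type*} [Fintype Ω] [Fintype α] {P : Ω → ℝ} {g : Ω → α} {p : α → ℝ}
    {r : Ω → Ω → Prop} (hP : ∑ x, P x = 1) (hr : ∀ x x', r x x')
    (hp : ∀ k : α → ℝ, ∑ x, P x * k (g x) = ∑ a, p a * k a) : Reveals P g p r 0 :=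
  ⟨fun _ => False, fun _ h => h.elim, fun x _ k => by simp [hr, hp, hP, classMass],
    fun k => by simp, hp⟩

/-- Product of two weight functions. -/
def prodLaw {α β : Type*} (p : α → ℝ) (p' : β → ℝ) : α × β → ℝ := fun x => p x.1 * p' x.2

lemma IsPMF.prodLaw {α β : Type*} [Fintype α] [Fintype β] {p : α → ℝ} {p' : β → ℝ}
    (hp : IsPMF p) (hp' : IsPMF p') : IsPMF (prodLaw p p') :=
  ⟨fun x => mul_nonneg (hp.1 _) (hp'.1 _), by
    simp [_root_.prodLaw, Fintype.sum_prod_type, ← Finset.mul_sum, hp.2, hp'.2]⟩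

/-- Joint law of three independent inputs and the output of a channel `W`. -/
def macLaw {α β γ Y : Type*} (pA : α → ℝ) (pB : β → ℝ) (pC : γ → ℝ)
    (W : α → β → γ → Y → ℝ) : α × β × γ × Y → ℝ :=
  fun x => pA x.1 * (pB x.2.1 * (pC x.2.2.1 * W x.1 x.2.1 x.2.2.1 x.2.2.2))

/-- Componentwise relation on three inputs and an output. -/
def macRel {α β γ Y : Type*} (a : α → α → Prop) (b : β → β → Prop) (c : γ → γ → Prop)
    (y : Y → Y → Prop) (x x' : α × β × γ × Y) : Prop :=
  a x.1 x'.1 ∧ b x.2.1 x'.2.1 ∧ c x.2.2.1 x'.2.2.1 ∧ y x.2.2.2 x'.2.2.2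

lemma macRel_equivalence {α β γ Y : Type*}
    {a : α → α → Prop} {b : β → β → Prop} {c : γ → γ → Prop}
    {y : Y → Y → Prop}
    (ha : Equivalence a) (hb : Equivalence b) (hc : Equivalence c) (hy : Equivalence y) :
    Equivalence (macRel a b c y) :=
  ⟨fun _ => ⟨ha.refl _, hb.refl _, hc.refl _, hy.refl _⟩,
    fun h => ⟨ha.symm h.1, hb.symm h.2.1, hc.symm h.2.2.1, hy.symm h.2.2.2⟩,
    fun h k => ⟨ha.trans h.1 k.1, hb.trans h.2.1 k.2.1, hc.trans h.2.2.1 k.2.2.1,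
      hy.trans h.2.2.2 k.2.2.2⟩⟩

/-- The entropy of the output of a multiple access channel given partial observations
of the three inputs. -/
def outEnt {α β γ Y : Type*} [Fintype α] [Fintype β] [Fintype γ] [Fintype Y]
    (pA : α → ℝ) (pB : β → ℝ) (pC : γ → ℝ) (W : α → β → γ → Y → ℝ)
    (a : α → α → Prop) (b : β → β → Prop) (c : γ → γ → Prop) : ℝ :=
  relEnt (macLaw pA pB pC W) (macRel a b c (agreeIf True))
    - relEnt (macLaw pA pB pC W) (macRel a b c (agreeIf False))

section Mac

variable {α β γ Y : Type*} [Fintype α] [Fintype β] [Fintype γ] [Fintype Y]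
  {pA : α → ℝ} {pB : β → ℝ} {pC : γ → ℝ}

lemma macLaw_isPMF (hA : IsPMF pA) (hB : IsPMF pB) (hC : IsPMF pC)
    {W : α → β → γ → Y → ℝ} (hW : ∀ a b c, IsPMF (W a b c)) : IsPMF (macLaw pA pB pC W) := by
  refine ⟨fun x => mul_nonneg (hA.1 _) (mul_nonneg (hB.1 _) (mul_nonneg (hC.1 _)
    ((hW _ _ _).1 _))), ?_⟩
  simp [macLaw, Fintype.sum_prod_type, ← Finset.mul_sum, (hW _ _ _).2, hA.2, hB.2, hC.2]

lemma outEnt_swap (W : α → β → γ → Y → ℝ)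
    (a : α → α → Prop) (b : β → β → Prop) (c : γ → γ → Prop) :
    outEnt pA pB pC W a b c = outEnt pB pA pC (fun y x => W x y) b a c := by
  let e : α × β × γ × Y ≃ β × α × γ × Y :=
    ⟨fun x => (x.2.1, x.1, x.2.2), fun x => (x.2.1, x.1, x.2.2), fun _ => rfl, fun _ => rfl⟩
  have key (y : Y → Y → Prop) : relEnt (macLaw pA pB pC W) (macRel a b c y)
      = relEnt (macLaw pB pA pC (fun y x => W x y)) (macRel b a c y) := by
    rw [relEnt_equiv e]
    have : (fun x => macLaw pA pB pC W (e.symm x)) = macLaw pB pA pC (fun y x => W x y) := by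
      funext x
      simp only [macLaw, e, Equiv.coe_fn_symm_mk]
      ring
    rw [this]
    refine relEnt_congr _ fun x x' => ?_
    simp only [macRel, e, Equiv.coe_fn_symm_mk]
    tauto
  simp only [outEnt, key]

lemma outEnt_split {Ω : Type*} [Fintype Ω] {P : Ω → ℝ} {g : Ω → α} {r : Ω → Ω → Prop} {ε : ℝ}
    (h : Reveals P g pA r ε) (hP : IsPMF P) (hr : ∀ x, r x x)
    (hA : IsPMF pA) (hB : IsPMF pB) (hC : IsPMF pC)
    {W : α → β → γ → Y → ℝ} (hW : ∀ a b c, IsPMF (W a b c))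
    {b : β → β → Prop} {c : γ → γ → Prop} (hb : ∀ x, b x x) (hc : ∀ x, c x x) :
    outEnt P pB pC (fun x => W (g x)) r b c
      = ε * outEnt pA pB pC W (agreeIf True) b c
        + (1 - ε) * outEnt pA pB pC W (agreeIf False) b c := by
  let V : α → β × γ × Y → ℝ := fun a z => pB z.1 * (pC z.2.1 * W a z.1 z.2.1 z.2.2)
  have hV (a : α) : IsPMF (V a) := by
    refine ⟨fun z => mul_nonneg (hB.1 _) (mul_nonneg (hC.1 _) ((hW _ _ _).1 _)), ?_⟩
    simp [V, Fintype.sum_prod_type, ← Finset.mul_sum, (hW _ _ _).2, hB.2, hC.2]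
  have h1 : Reveals pA id pA (agreeIf True) 1 :=
    reveals_true (fun x x' h => (h trivial).symm) (fun _ => rfl)
  have h0 : Reveals pA id pA (agreeIf False) 0 :=
    reveals_false hA.2 (fun x x' h => h.elim) (fun _ => rfl)
  have key (d : Prop) := relEnt_split h hP.1 hr hV
    (r' := fun z z' => b z.1 z'.1 ∧ c z.2.1 z'.2.1 ∧ agreeIf d z.2.2 z'.2.2)
    (fun z => ⟨hb _, hc _, fun _ => rfl⟩)
  have key1 (d : Prop) := relEnt_split h1 hA.1 (agreeIf_equivalence _).refl hV
    (r' := fun z z' => b z.1 z'.1 ∧ c z.2.1 z'.2.1 ∧ agreeIf d z.2.2 z'.2.2)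
    (fun z => ⟨hb _, hc _, fun _ => rfl⟩)
  have key0 (d : Prop) := relEnt_split h0 hA.1 (agreeIf_equivalence _).refl hV
    (r' := fun z z' => b z.1 z'.1 ∧ c z.2.1 z'.2.1 ∧ agreeIf d z.2.2 z'.2.2)
    (fun z => ⟨hb _, hc _, fun _ => rfl⟩)
  change ∀ d, relEnt (macLaw P pB pC fun x => W (g x)) (macRel r b c (agreeIf d)) = _ at key
  change ∀ d, relEnt (macLaw pA pB pC W) (macRel (agreeIf True) b c (agreeIf d)) = _ at key1
  change ∀ d, relEnt (macLaw pA pB pC W) (macRel (agreeIf False) b c (agreeIf d)) = _ at key0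
  simp only [outEnt, key, key1, key0]
  ring

lemma relEnt_macRel_inputs (hA : IsPMF pA) (hB : IsPMF pB) (hC : IsPMF pC)
    {W : α → β → γ → Y → ℝ} (hW : ∀ a b c, IsPMF (W a b c))
    {a : α → α → Prop} {b : β → β → Prop} {c : γ → γ → Prop}
    (ha : ∀ x, a x x) (hb : ∀ x, b x x) (hc : ∀ x, c x x) :
    relEnt (macLaw pA pB pC W) (macRel a b c (agreeIf False))
      = relEnt pA a + (relEnt pB b + relEnt pC c) := by
  let e : α × β × γ × Y ≃ (α × β × γ) × Y :=
    ⟨fun x => ((x.1, x.2.1, x.2.2.1), x.2.2.2), fun x => (x.1.1, x.1.2.1, x.1.2.2, x.2),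
      fun _ => rfl, fun _ => rfl⟩
  rw [← relEnt_prod hB hC hb hc]
  rw [← relEnt_prod hA (p' := fun x : β × γ => pB x.1 * pC x.2)
    (hB.prodLaw hC) ha (r' := fun x x' => b x.1 x'.1 ∧ c x.2 x'.2) (fun x => ⟨hb _, hc _⟩)]
  rw [relEnt_equiv e]
  refine (relEnt_congr _ (r' := fun x x' => a x.1.1 x'.1.1 ∧ b x.1.2.1 x'.1.2.1 ∧
    c x.1.2.2 x'.1.2.2) fun x x' => ?_).trans ?_
  · simp [macRel, e, agreeIf]
  · rw [relEnt_marginal _ (fun x x' : α × β × γ => a x.1 x'.1 ∧ b x.2.1 x'.2.1 ∧ c x.2.2 x'.2.2)]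
    congr 1
    funext x
    simp [macLaw, e, ← Finset.mul_sum, (hW _ _ _).2]

/-- Four partitions of a probability space, with union and intersection observations
of two of them, for which entropy is modular. -/
structure ModularQuad {Ω : Type*} [Fintype Ω] (p : Ω → ℝ) (r₁ r₂ u i : Ω → Ω → Prop) : Prop where
  equiv₁ : Equivalence r₁
  equiv₂ : Equivalence r₂
  equiv_inf : Equivalence i
  union_iff : ∀ x x', u x x' ↔ r₁ x x' ∧ r₂ x x'
  le₁ : ∀ x x', r₁ x x' → i x x'
  le₂ : ∀ x x', r₂ x x' → i x x'
  modular : relEnt p u + relEnt p i = relEnt p r₁ + relEnt p r₂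

lemma ModularQuad.refl_union {Ω : Type*} [Fintype Ω] {p : Ω → ℝ} {r₁ r₂ u i : Ω → Ω → Prop}
    (h : ModularQuad p r₁ r₂ u i) (x : Ω) : u x x :=
  (h.union_iff x x).2 ⟨h.equiv₁.refl x, h.equiv₂.refl x⟩

lemma modularQuad_agreeIf {Ω : Type*} [Fintype Ω] (p : Ω → ℝ) (c d : Prop) :
    ModularQuad p (agreeIf c) (agreeIf d) (agreeIf (c ∨ d)) (agreeIf (c ∧ d)) where
  equiv₁ := agreeIf_equivalence _
  equiv₂ := agreeIf_equivalence _
  equiv_inf := agreeIf_equivalence _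
  union_iff x x' := by
    unfold agreeIf
    tauto
  le₁ x x' h hc := h hc.1
  le₂ x x' h hc := h hc.2
  modular := by
    by_cases hc : c <;> by_cases hd : d <;> simp [hc, hd, add_comm]

lemma ModularQuad.prod {Ω Z : Type*} [Fintype Ω] [Fintype Z] {p : Ω → ℝ} {p' : Z → ℝ}
    (hp : IsPMF p) (hp' : IsPMF p') {r₁ r₂ u i : Ω → Ω → Prop} {s₁ s₂ v j : Z → Z → Prop}
    (h : ModularQuad p r₁ r₂ u i) (h' : ModularQuad p' s₁ s₂ v j) :
    ModularQuad (prodLaw p p') (fun x x' => r₁ x.1 x'.1 ∧ s₁ x.2 x'.2)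
      (fun x x' => r₂ x.1 x'.1 ∧ s₂ x.2 x'.2) (fun x x' => u x.1 x'.1 ∧ v x.2 x'.2)
      (fun x x' => i x.1 x'.1 ∧ j x.2 x'.2) where
  equiv₁ := ⟨fun x => ⟨h.equiv₁.refl _, h'.equiv₁.refl _⟩,
    fun k => ⟨h.equiv₁.symm k.1, h'.equiv₁.symm k.2⟩,
    fun k l => ⟨h.equiv₁.trans k.1 l.1, h'.equiv₁.trans k.2 l.2⟩⟩
  equiv₂ := ⟨fun x => ⟨h.equiv₂.refl _, h'.equiv₂.refl _⟩,
    fun k => ⟨h.equiv₂.symm k.1, h'.equiv₂.symm k.2⟩,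
    fun k l => ⟨h.equiv₂.trans k.1 l.1, h'.equiv₂.trans k.2 l.2⟩⟩
  equiv_inf := ⟨fun x => ⟨h.equiv_inf.refl _, h'.equiv_inf.refl _⟩,
    fun k => ⟨h.equiv_inf.symm k.1, h'.equiv_inf.symm k.2⟩,
    fun k l => ⟨h.equiv_inf.trans k.1 l.1, h'.equiv_inf.trans k.2 l.2⟩⟩
  union_iff x x' := by
    rw [h.union_iff, h'.union_iff]
    tauto
  le₁ x x' k := ⟨h.le₁ _ _ k.1, h'.le₁ _ _ k.2⟩
  le₂ x x' k := ⟨h.le₂ _ _ k.1, h'.le₂ _ _ k.2⟩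
  modular := by
    have e := @relEnt_prod Ω Z _ _ p p' hp hp'
    change ∀ {r r'}, _ → _ → relEnt (prodLaw p p') _ = _ at e
    rw [e h.refl_union h'.refl_union, e h.equiv_inf.refl h'.equiv_inf.refl,
      e h.equiv₁.refl h'.equiv₁.refl, e h.equiv₂.refl h'.equiv₂.refl]
    linarith [h.modular, h'.modular]

lemma outEnt_submodular (hA : IsPMF pA) (hB : IsPMF pB) (hC : IsPMF pC)
    {W : α → β → γ → Y → ℝ} (hW : ∀ a b c, IsPMF (W a b c))
    {a₁ a₂ au ai : α → α → Prop} {b₁ b₂ bu bi : β → β → Prop} {c₁ c₂ cu ci : γ → γ → Prop}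
    (ha : ModularQuad pA a₁ a₂ au ai) (hb : ModularQuad pB b₁ b₂ bu bi)
    (hc : ModularQuad pC c₁ c₂ cu ci) :
    outEnt pA pB pC W au bu cu + outEnt pA pB pC W ai bi ci
      ≤ outEnt pA pB pC W a₁ b₁ c₁ + outEnt pA pB pC W a₂ b₂ c₂ := by
  have hs := relEnt_submodular (macLaw_isPMF hA hB hC hW).1
    (macRel_equivalence ha.equiv₁ hb.equiv₁ hc.equiv₁ (agreeIf_equivalence (α := Y) True))
    (macRel_equivalence ha.equiv₂ hb.equiv₂ hc.equiv₂ (agreeIf_equivalence (α := Y) True))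
    (macRel_equivalence ha.equiv_inf hb.equiv_inf hc.equiv_inf
      (agreeIf_equivalence (α := Y) True))
    (fun x y h => ⟨ha.le₁ _ _ h.1, hb.le₁ _ _ h.2.1, hc.le₁ _ _ h.2.2.1, h.2.2.2⟩)
    (fun x y h => ⟨ha.le₂ _ _ h.1, hb.le₂ _ _ h.2.1, hc.le₂ _ _ h.2.2.1, h.2.2.2⟩)
  rw [relEnt_congr _ (r' := macRel au bu cu (agreeIf True)) fun x x' => by
    simp only [macRel, ha.union_iff, hb.union_iff, hc.union_iff]
    tauto] at hs
  have e := @relEnt_macRel_inputs _ _ _ _ _ _ _ _ _ _ _ hA hB hC W hW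
  unfold outEnt
  rw [e ha.refl_union hb.refl_union hc.refl_union,
    e ha.equiv_inf.refl hb.equiv_inf.refl hc.equiv_inf.refl,
    e ha.equiv₁.refl hb.equiv₁.refl hc.equiv₁.refl,
    e ha.equiv₂.refl hb.equiv₂.refl hc.equiv₂.refl]
  linarith [ha.modular, hb.modular, hc.modular]

end Mac

/-- Information about the output of a multiple access channel (up to an additive constant)
provided by the inputs whose flag holds. -/
def macInfo {α β γ Y : Type*} [Fintype α] [Fintype β] [Fintype γ] [Fintype Y]
    (pA : α → ℝ) (pB : β → ℝ) (pC : γ → ℝ) (W : α → β → γ → Y → ℝ) (a b c : Prop) : ℝ :=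
  -outEnt pA pB pC W (agreeIf a) (agreeIf b) (agreeIf c)

/-- Supermodularity of a set function on three elements, given through flags. -/
def FlagSupermodular (f : Prop → Prop → Prop → ℝ) : Prop :=
  ∀ a b c a' b' c', f a b c + f a' b' c' ≤ f (a ∨ a') (b ∨ b') (c ∨ c') + f (a ∧ a') (b ∧ b') (c ∧ c')

lemma macInfo_supermodular {α β γ Y : Type*} [Fintype α] [Fintype β] [Fintype γ] [Fintype Y]
    {pA : α → ℝ} {pB : β → ℝ} {pC : γ → ℝ} (hA : IsPMF pA) (hB : IsPMF pB) (hC : IsPMF pC)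
    {W : α → β → γ → Y → ℝ} (hW : ∀ a b c, IsPMF (W a b c)) :
    FlagSupermodular (macInfo pA pB pC W) := by
  intro a b c a' b' c'
  have := outEnt_submodular hA hB hC hW (modularQuad_agreeIf pA a a') (modularQuad_agreeIf pB b b')
    (modularQuad_agreeIf pC c c')
  unfold macInfo
  linarith

/-- Agreement of the first three layers selected by `X`. -/
def layerRel₃ {A B C : Type*} (X : Finset (Fin 6)) (x x' : A × B × C) : Prop :=
  agreeIf (0 ∈ X) x.1 x'.1 ∧ agreeIf (1 ∈ X) x.2.1 x'.2.1 ∧ agreeIf (2 ∈ X) x.2.2 x'.2.2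

/-- Agreement of the fourth and fifth layers selected by `X`. -/
def layerRel₂ {A B : Type*} (X : Finset (Fin 6)) (x x' : A × B) : Prop :=
  agreeIf (3 ∈ X) x.1 x'.1 ∧ agreeIf (4 ∈ X) x.2 x'.2

lemma layerRel₃_refl {A B C : Type*} (X : Finset (Fin 6)) (x : A × B × C) : layerRel₃ X x x :=
  ⟨fun _ => rfl, fun _ => rfl, fun _ => rfl⟩

lemma layerRel₂_refl {A B : Type*} (X : Finset (Fin 6)) (x : A × B) : layerRel₂ X x x :=
  ⟨fun _ => rfl, fun _ => rfl⟩

/-- Information about the output provided by the layers in `X`, when the first input is split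
into layers `0, 1, 2`, the second into layers `3, 4`, and the third is layer `5`. -/
def layerInfo {A B C D E γ Y : Type*} [Fintype A] [Fintype B] [Fintype C] [Fintype D] [Fintype E]
    [Fintype γ] [Fintype Y] (P : A × B × C → ℝ) (P' : D × E → ℝ) (pC : γ → ℝ)
    (W : A × B × C → D × E → γ → Y → ℝ) (X : Finset (Fin 6)) : ℝ :=
  -outEnt P P' pC W (layerRel₃ X) (layerRel₂ X) (agreeIf (5 ∈ X))

/-- Supermodularity of a set function. -/
def SetSupermodular (h : Finset (Fin 6) → ℝ) : Prop :=
  ∀ X Z, h X + h Z ≤ h (X ∪ Z) + h (X ∩ Z)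

section Layers

variable {A B C D E γ Y : Type*} [Fintype A] [Fintype B] [Fintype C] [Fintype D] [Fintype E]
  [Fintype γ] [Fintype Y]

lemma layerInfo_supermodular {p₀ : A → ℝ} {p₁ : B → ℝ} {p₂ : C → ℝ} {p₃ : D → ℝ} {p₄ : E → ℝ}
    {pC : γ → ℝ} (h₀ : IsPMF p₀) (h₁ : IsPMF p₁) (h₂ : IsPMF p₂) (h₃ : IsPMF p₃) (h₄ : IsPMF p₄)
    (hC : IsPMF pC) {W : A × B × C → D × E → γ → Y → ℝ} (hW : ∀ a b c, IsPMF (W a b c)) :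
    SetSupermodular (layerInfo (prodLaw p₀ (prodLaw p₁ p₂)) (prodLaw p₃ p₄) pC W) := by
  intro X Z
  have := outEnt_submodular (h₀.prodLaw (h₁.prodLaw h₂)) (h₃.prodLaw h₄) hC hW
    ((modularQuad_agreeIf p₀ (0 ∈ X) (0 ∈ Z)).prod h₀ (h₁.prodLaw h₂)
      ((modularQuad_agreeIf p₁ (1 ∈ X) (1 ∈ Z)).prod h₁ h₂
        (modularQuad_agreeIf p₂ (2 ∈ X) (2 ∈ Z))))
    ((modularQuad_agreeIf p₃ (3 ∈ X) (3 ∈ Z)).prod h₃ h₄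
        (modularQuad_agreeIf p₄ (4 ∈ X) (4 ∈ Z)))
    (modularQuad_agreeIf pC (5 ∈ X) (5 ∈ Z))
  unfold layerInfo layerRel₃ layerRel₂
  simp only [Finset.mem_union, Finset.mem_inter]
  linarith

/-- Multilinear interpolation of a flag function in its first two arguments. -/
def interp (f : Prop → Prop → Prop → ℝ) (ε δ : ℝ) (c : Prop) : ℝ :=
  ε * (δ * f True True c + (1 - δ) * f True False c)
    + (1 - ε) * (δ * f False True c + (1 - δ) * f False False c)

lemma layerInfo_eq_interp {α β : Type*} [Fintype α] [Fintype β] {P : A × B × C → ℝ}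
    {P' : D × E → ℝ} {pA : α → ℝ} {pB : β → ℝ} {pC : γ → ℝ} (hP : IsPMF P) (hP' : IsPMF P')
    (hA : IsPMF pA) (hB : IsPMF pB) (hC : IsPMF pC) {W : α → β → γ → Y → ℝ}
    (hW : ∀ a b c, IsPMF (W a b c)) {g : A × B × C → α} {g' : D × E → β} {X : Finset (Fin 6)}
    {ε δ : ℝ} (h : Reveals P g pA (layerRel₃ X) ε) (h' : Reveals P' g' pB (layerRel₂ X) δ) :
    layerInfo P P' pC (fun x y => W (g x) (g' y)) X
      = interp (macInfo pA pB pC W) ε δ (5 ∈ X) := by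
  have e1 := outEnt_split h hP (layerRel₃_refl X) hA hP' hC
    (W := fun a y => W a (g' y)) (fun a b c => hW _ _ _) (layerRel₂_refl X)
    (agreeIf_equivalence (5 ∈ X)).refl
  have e2 (d : Prop) := outEnt_split h' hP' (layerRel₂_refl X) hB hA hC
    (W := fun b a => W a b) (fun a b c => hW _ _ _) (agreeIf_equivalence d).refl
    (agreeIf_equivalence (5 ∈ X)).refl
  have e3 (d : Prop) : outEnt pA P' pC (fun a y => W a (g' y)) (agreeIf d) (layerRel₂ X)
        (agreeIf (5 ∈ X))
      = δ * outEnt pA pB pC W (agreeIf d) (agreeIf True) (agreeIf (5 ∈ X))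
        + (1 - δ) * outEnt pA pB pC W (agreeIf d) (agreeIf False) (agreeIf (5 ∈ X)) := by
    rw [outEnt_swap W (agreeIf d) (agreeIf True), outEnt_swap W (agreeIf d) (agreeIf False),
      ← e2 d]
    exact outEnt_swap _ _ _ _
  unfold layerInfo interp macInfo
  rw [e1, e3, e3]
  ring

end Layers

/-- Total information increment of the layers in `A` when the layers of a list are decoded in
order, the layers in `P` being known beforehand. -/
def gain (h : Finset (Fin 6) → ℝ) (A : Finset (Fin 6)) :
    List (Fin 6) → Finset (Fin 6) → ℝ
  | [], _ => 0
  | i :: l, P => (if i ∈ A then h (insert i P) - h P else 0) + gain h A l (insert i P)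

lemma gain_le {h : Finset (Fin 6) → ℝ} (hh : SetSupermodular h) (A : Finset (Fin 6))
    (l : List (Fin 6)) (P : Finset (Fin 6)) :
    gain h A l P ≤ h (P ∪ l.toFinset ∪ Aᶜ) - h (P ∪ Aᶜ) := by
  induction l generalizing P with
  | nil => simp [gain]
  | cons i l ih =>
    have := ih (insert i P)
    have e : P ∪ (i :: l).toFinset ∪ Aᶜ = insert i P ∪ l.toFinset ∪ Aᶜ := by
      ext x
      simp
    rw [gain, e]
    by_cases hi : i ∈ A
    · have e1 : insert i P ∪ (P ∪ Aᶜ) = insert i P ∪ Aᶜ := by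
        ext x
        simp
      have e2 : insert i P ∩ (P ∪ Aᶜ) = P := by
        ext x
        simp only [Finset.mem_inter, Finset.mem_insert, Finset.mem_union, Finset.mem_compl]
        constructor
        · rintro ⟨rfl | hx, hx' | hx'⟩ <;> first | assumption | contradiction
        · tauto
      have := hh (insert i P) (P ∪ Aᶜ)
      rw [e1, e2] at this
      rw [if_pos hi]
      linarith
    · have e1 : insert i P ∪ Aᶜ = P ∪ Aᶜ := by
        ext x
        simp only [Finset.mem_insert, Finset.mem_union, Finset.mem_compl]
        constructor
        · rintro ((rfl | hx) | hx) <;> tauto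
        · tauto
      rw [e1] at this
      rw [if_neg hi]
      linarith

lemma gain_union (h : Finset (Fin 6) → ℝ) {A A' : Finset (Fin 6)} (hA : Disjoint A A')
    (l : List (Fin 6)) (P : Finset (Fin 6)) :
    gain h (A ∪ A') l P = gain h A l P + gain h A' l P := by
  induction l generalizing P with
  | nil => simp [gain]
  | cons i l ih =>
    have this : i ∈ A → i ∉ A' := fun h => Finset.disjoint_left.1 hA h
    by_cases h1 : i ∈ A
    · simp [gain, ih, h1, this h1]
      ring
    · by_cases h2 : i ∈ A' <;> simp [gain, ih, h1, h2]
      ring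

/-- Rate bounds of successive cancellation decoding of the layers in the order `l`. -/
def SCBounds (h : Finset (Fin 6) → ℝ) (l : List (Fin 6)) (x y z : ℝ) : Prop :=
  x ≤ gain h {0, 1, 2} l ∅ ∧ y ≤ gain h {3, 4} l ∅ ∧ z ≤ gain h {5} l ∅

/-- The seven rate bounds of a three-user multiple access channel with information function `f`. -/
def MACBounds (f : Prop → Prop → Prop → ℝ) (x y z : ℝ) : Prop :=
  x ≤ f True True True - f False True True ∧
  y ≤ f True True True - f True False True ∧
  z ≤ f True True True - f True True False ∧
  x + y ≤ f True True True - f False False True ∧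
  x + z ≤ f True True True - f False True False ∧
  y + z ≤ f True True True - f True False False ∧
  x + y + z ≤ f True True True - f False False False

lemma SCBounds.macBounds {h : Finset (Fin 6) → ℝ} (hh : SetSupermodular h)
    {f : Prop → Prop → Prop → ℝ}
    (hf : ∀ X : Finset (Fin 6), (0 ∈ X ↔ 1 ∈ X) → (0 ∈ X ↔ 2 ∈ X) → (3 ∈ X ↔ 4 ∈ X) →
      h X = f (0 ∈ X) (3 ∈ X) (5 ∈ X))
    {l : List (Fin 6)} (hl : l.toFinset = Finset.univ) {x y z : ℝ} (hr : SCBounds h l x y z) :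
    MACBounds f x y z := by
  obtain ⟨hx, hy, hz⟩ := hr
  have key (A : Finset (Fin 6)) : gain h A l ∅ ≤ h Finset.univ - h Aᶜ := by
    have := gain_le hh A l ∅
    rwa [hl, Finset.empty_union, Finset.empty_union,
      show Finset.univ ∪ Aᶜ = Finset.univ by ext; simp] at this
  have d12 := gain_union h (A := {0, 1, 2}) (A' := {3, 4}) (by decide) l ∅
  have d13 := gain_union h (A := {0, 1, 2}) (A' := {5}) (by decide) l ∅
  have d23 := gain_union h (A := {3, 4}) (A' := {5}) (by decide) l ∅
  have d123 := gain_union h (A := {0, 1, 2} ∪ {3, 4}) (A' := {5}) (by decide) l ∅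
  have k1 := key {0, 1, 2}
  have k2 := key {3, 4}
  have k3 := key {5}
  have k12 := key ({0, 1, 2} ∪ {3, 4})
  have k13 := key ({0, 1, 2} ∪ {5})
  have k23 := key ({3, 4} ∪ {5})
  have k123 := key ({0, 1, 2} ∪ {3, 4} ∪ {5})
  rw [d12] at k12
  rw [d13] at k13
  rw [d23] at k23
  rw [d123, d12] at k123
  rw [hf _ (by decide) (by decide) (by decide), hf _ (by decide) (by decide) (by decide)]
    at k1 k2 k3 k12 k13 k23 k123
  simp [-not_or] at k1 k2 k3 k12 k13 k23 k123
  refine ⟨?_, ?_, ?_, ?_, ?_, ?_, ?_⟩ <;> linarith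

lemma exists_affine_eq {p q x : ℝ} (hp : p ≤ x) (hq : x ≤ q) :
    ∃ t, 0 ≤ t ∧ t ≤ 1 ∧ x = (1 - t) * p + t * q := by
  rcases (hp.trans hq).eq_or_lt with h | h
  · exact ⟨0, le_rfl, zero_le_one, by linarith⟩
  · refine ⟨(x - p) / (q - p), div_nonneg (by linarith) (by linarith),
      (div_le_one (by linarith)).2 (by linarith), ?_⟩
    have : q - p ≠ 0 := by linarith
    field_simp
    ring

lemma exists_affine_eq_of_ge {p q x : ℝ} (hp : x ≤ p) (hq : q ≤ x) :
    ∃ t, 0 ≤ t ∧ t ≤ 1 ∧ x = (1 - t) * p + t * q := by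
  obtain ⟨t, h0, h1, h⟩ := exists_affine_eq hq hp
  exact ⟨1 - t, by linarith, by linarith, by linarith⟩

lemma exists_le_tight {a b c d x : ℝ} (ha : x ≤ a) (hb : x ≤ b) (hc : x ≤ c) (hd : x ≤ d) :
    ∃ x', x ≤ x' ∧ x' ≤ a ∧ x' ≤ b ∧ x' ≤ c ∧ x' ≤ d ∧
      (x' = a ∨ x' = b ∨ x' = c ∨ x' = d) := by
  refine ⟨min (min a b) (min c d), by simp [*], by simp, by simp, by simp, by simp, ?_⟩
  rcases min_choice (min a b) (min c d) with h | h <;> rw [h]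
  · rcases min_choice a b with h | h <;> simp [h]
  · rcases min_choice c d with h | h <;> simp [h]

/-- A rate vector in a multiple access region is dominated by one of maximal sum rate. -/
lemma MACBounds.exists_ge {f : Prop → Prop → Prop → ℝ} (hf : FlagSupermodular f) {x y z : ℝ}
    (h : MACBounds f x y z) : ∃ x' y' z', x ≤ x' ∧ y ≤ y' ∧ z ≤ z' ∧ MACBounds f x' y' z' ∧
      x' + y' + z' = f True True True - f False False False := by
  obtain ⟨h1, h2, h3, h4, h5, h6, h7⟩ := h
  have s1 := hf True False False False True False
  have s2 := hf True False False False False True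
  have s3 := hf False True False False False True
  have s4 := hf True True False True False True
  have s5 := hf True True False False True True
  have s6 := hf True False True False True True
  have s7 := hf True True False False False True
  have s8 := hf True False True False True False
  have s9 := hf False True True True False False
  simp only [or_true, or_false, or_self, and_true, and_false, and_self] at s1 s2 s3 s4 s5 s6 s7 s8 s9
  obtain ⟨x', hx, x1, x2, x3, x4, hx'⟩ := exists_le_tight (x := x)
    (a := f True True True - f False True True) (b := f True True True - f False False True - y)
    (c := f True True True - f False True False - z)
    (d := f True True True - f False False False - y - z)
    (by linarith) (by linarith) (by linarith) (by linarith)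
  obtain ⟨y', hy, y1, y2, y3, y4, hy'⟩ := exists_le_tight (x := y)
    (a := f True True True - f True False True) (b := f True True True - f False False True - x')
    (c := f True True True - f True False False - z)
    (d := f True True True - f False False False - x' - z)
    (by linarith) (by linarith) (by linarith) (by linarith)
  obtain ⟨z', hz, z1, z2, z3, z4, hz'⟩ := exists_le_tight (x := z)
    (a := f True True True - f True True False) (b := f True True True - f False True False - x')
    (c := f True True True - f True False False - y')
    (d := f True True True - f False False False - x' - y')
    (by linarith) (by linarith) (by linarith) (by linarith)
  refine ⟨x', y', z', hx, hy, hz, ⟨x1, y1, z1, ?_, ?_, ?_, ?_⟩, le_antisymm ?_ ?_⟩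
  any_goals linarith
  rcases hx' with h | h | h | h <;> rcases hy' with h' | h' | h' | h' <;>
    rcases hz' with h'' | h'' | h'' | h'' <;> linarith

/-- The three families of rate points attained by the layer orders at one receiver, the first
message being split at level `α` and the second at level `τ`. -/
inductive OrderKind
  | first | second | third

/-- Rates (componentwise bounds) attained when the first message is cut at level `α` and the
second at level `τ`. -/
def SplitBounds (f : Prop → Prop → Prop → ℝ) (α τ x y z : ℝ) : OrderKind → Prop
  | .first =>
    x ≤ interp f α 0 False - interp f 0 0 False + (interp f 1 τ False - interp f α τ False) ∧
    y ≤ interp f α τ False - interp f α 0 False + (interp f 1 1 True - interp f 1 τ True) ∧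
    z ≤ interp f 1 τ True - interp f 1 τ False
  | .second =>
    x ≤ interp f α τ True - interp f 0 τ True + (interp f 1 1 True - interp f α 1 True) ∧
    y ≤ interp f 0 τ False - interp f 0 0 False + (interp f α 1 True - interp f α τ True) ∧
    z ≤ interp f 0 τ True - interp f 0 τ False
  | .third =>
    x ≤ interp f α τ False - interp f 0 τ False + (interp f 1 τ True - interp f α τ True) ∧
    y ≤ interp f 0 τ False - interp f 0 0 False + (interp f 1 1 True - interp f 1 τ True) ∧
    z ≤ interp f α τ True - interp f α τ False

lemma MACBounds.exists_splitBounds {f : Prop → Prop → Prop → ℝ} (hf : FlagSupermodular f)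
    {x y z : ℝ} (h : MACBounds f x y z) :
    ∃ α τ, 0 ≤ α ∧ α ≤ 1 ∧ 0 ≤ τ ∧ τ ≤ 1 ∧ ∃ k, SplitBounds f α τ x y z k := by
  obtain ⟨x', y', z', hx, hy, hz, ⟨h1, h2, h3, h4, h5, h6, -⟩, h7⟩ := h.exists_ge hf
  have s1 := hf True False False False True False
  have s2 := hf True False False False False True
  have s3 := hf False True False False False True
  have s4 := hf True True False True False True
  have s5 := hf True True False False True True
  have s6 := hf True False True False True True
  simp only [or_true, or_false, or_self, and_true, and_false, and_self] at s1 s2 s3 s4 s5 s6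
  suffices key : ∃ α τ, 0 ≤ α ∧ α ≤ 1 ∧ 0 ≤ τ ∧ τ ≤ 1 ∧ ∃ k, SplitBounds f α τ x' y' z' k by
    obtain ⟨α, τ, a1, a2, a3, a4, k, hk⟩ := key
    refine ⟨α, τ, a1, a2, a3, a4, k, ?_⟩
    cases k <;> obtain ⟨b1, b2, b3⟩ := hk <;>
      exact ⟨hx.trans b1, hy.trans b2, hz.trans b3⟩
  clear hx hy hz h x y z
  set o := f False False False
  set a := f True False False
  set b := f False True False
  set c := f False False True
  set ab := f True True False
  set ac := f True False True
  set bc := f False True True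
  set abc := f True True True
  obtain ⟨τ, t0, t1, ht⟩ := exists_affine_eq_of_ge (x := y') (p := abc - ac) (q := b - o)
    (by linarith) (by linarith)
  by_cases hl : x' < (1 - τ) * (a - o) + τ * (ab - b)
  · obtain ⟨t, u0, u1, hu⟩ := exists_affine_eq (x := z')
      (p := (1 - τ) * (ac - a) + τ * (abc - ab)) (q := abc - ab) (by linarith) (by linarith)
    have hτ : 0 ≤ t * (1 - τ) := mul_nonneg u0 (by linarith)
    have hs : 0 ≤ t * (1 - τ) * (ab - b - (a - o)) := mul_nonneg hτ (by linarith)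
    obtain ⟨α, v0, v1, hv⟩ := exists_affine_eq_of_ge (x := x')
      (p := (1 - (τ + t * (1 - τ))) * (a - o) + (τ + t * (1 - τ)) * (ab - b)) (q := a - o)
      (by linarith) (by linarith)
    refine ⟨α, τ + t * (1 - τ), v0, v1, by linarith, ?_, .first, le_of_eq ?_, le_of_eq ?_,
      le_of_eq ?_⟩
    · nlinarith
    all_goals unfold interp
    · linear_combination hv
    · linear_combination h7 - hv - hu
    · linear_combination hu
  by_cases hr : (1 - τ) * (ac - c) + τ * (abc - bc) < x'
  · obtain ⟨t, u0, u1, hu⟩ := exists_affine_eq_of_ge (x := z')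
      (p := (1 - τ) * (c - o) + τ * (bc - b)) (q := c - o) (by linarith) (by linarith)
    have hτ : 0 ≤ t * τ := mul_nonneg u0 t0
    have hs : 0 ≤ t * τ * (abc - bc - (ac - c)) := mul_nonneg hτ (by linarith)
    obtain ⟨α, v0, v1, hv⟩ := exists_affine_eq_of_ge (x := x') (p := abc - bc)
      (q := (1 - (τ - t * τ)) * (ac - c) + (τ - t * τ) * (abc - bc))
      (by linarith) (by linarith)
    refine ⟨α, τ - t * τ, v0, v1, ?_, by linarith, .second, le_of_eq ?_, le_of_eq ?_,
      le_of_eq ?_⟩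
    · nlinarith
    all_goals unfold interp
    · linear_combination hv
    · linear_combination h7 - hv - hu
    · linear_combination hu
  · obtain ⟨α, v0, v1, hv⟩ := exists_affine_eq_of_ge (x := x')
      (p := (1 - τ) * (ac - c) + τ * (abc - bc)) (q := (1 - τ) * (a - o) + τ * (ab - b))
      (by linarith) (by linarith)
    refine ⟨α, τ, v0, v1, t0, t1, .third, le_of_eq ?_, le_of_eq ?_, le_of_eq ?_⟩
    all_goals unfold interp
    · linear_combination hv
    · linear_combination ht
    · linear_combination h7 - hv - ht

/-- The law `p` erased (sent to `none`) with probability `1 - α`. -/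
def erased {α : Type*} (t : ℝ) (p : α → ℝ) : Option α → ℝ
  | none => 1 - t
  | some a => t * p a

lemma erased_isPMF {α : Type*} [Fintype α] {t : ℝ} (h0 : 0 ≤ t) (h1 : t ≤ 1) {p : α → ℝ}
    (hp : IsPMF p) : IsPMF (erased t p) := by
  refine ⟨fun x => ?_, by simp [erased, Fintype.sum_option, ← Finset.mul_sum, hp.2]⟩
  cases x with
  | none => exact sub_nonneg.2 h1
  | some a => exact mul_nonneg h0 (hp.1 a)

lemma reveals_agreeIf {α : Type*} [Fintype α] {p : α → ℝ} (hp : IsPMF p) (c : Prop) [Decidable c] :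
    Reveals p id p (agreeIf c) (if c then 1 else 0) := by
  by_cases hc : c
  · rw [if_pos hc]
    exact reveals_true (fun x x' h => (h hc).symm) fun _ => rfl
  · rw [if_neg hc]
    exact reveals_false hp.2 (fun x x' h => (hc h).elim) fun _ => rfl

lemma Reveals.erased {Z α : Type*} [Fintype Z] [Fintype α] {Q : Z → ℝ} {g : Z → α} {p : α → ℝ}
    {r : Z → Z → Prop} {ε : ℝ} (h : Reveals Q g p r ε) (hQ : ∑ z, Q z = 1) (t : ℝ)
    {c : Prop} (hc : c) :
    Reveals (prodLaw (erased t p) Q) (fun x => x.1.getD (g x.2)) p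
      (fun x x' => agreeIf c x.1 x'.1 ∧ r x.2 x'.2) (t + (1 - t) * ε) := by
  obtain ⟨R, hR, hN, hε, hp⟩ := h
  have pull (d : Prop) (b : ℝ) : (if d then (1 - t) * b else 0) = (1 - t) * if d then b else 0 :=
    (mul_ite_zero _ _ _).symm
  refine ⟨fun x => x.1.isSome ∨ R x.2, ?_, ?_, ?_, ?_⟩
  · rintro ⟨o, z⟩ hx ⟨o', z'⟩ ⟨h1, h2⟩
    obtain rfl : o = o' := h1 hc
    cases o with
    | none => exact hR z (by simpa using hx) z' h2
    | some a => rfl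
  · rintro ⟨o, z⟩ hx k
    cases o with
    | some a => simp at hx
    | none =>
      have := hN z (by simpa using hx) k
      simp only [classMass, Fintype.sum_prod_type, Fintype.sum_option, prodLaw, _root_.erased,
        agreeIf, hc, forall_const, true_and, reduceCtorEq, false_and, if_false,
        Finset.sum_const_zero, add_zero, Option.getD_none, mul_assoc] at this ⊢
      simp only [pull, ← Finset.mul_sum, this, mul_assoc]
  · intro k
    simp only [Fintype.sum_prod_type, Fintype.sum_option, prodLaw, _root_.erased,
      Option.isSome_some, Option.isSome_none, true_or, if_true, Bool.false_eq_true, false_or,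
      Option.getD_none, Option.getD_some, mul_assoc]
    simp only [pull, ← Finset.mul_sum, hε, ← Finset.sum_mul, hQ, one_mul]
    ring
  · intro k
    simp only [Fintype.sum_prod_type, Fintype.sum_option, prodLaw, _root_.erased,
      Option.getD_none, Option.getD_some, mul_assoc]
    simp only [← Finset.mul_sum, hp, ← Finset.sum_mul, hQ, one_mul]
    ring

/-- Fraction of the first message revealed by the layers in `X`, the levels of the cumulated
layers being `s`, `s'` and `1`. -/
def level₃ (s s' : ℝ) (X : Finset (Fin 6)) : ℝ :=
  if 2 ∈ X then 1 else if 1 ∈ X then s' else if 0 ∈ X then s else 0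

/-- Fraction of the second message revealed by the layers in `X`, the levels of the cumulated
layers being `t` and `1`. -/
def level₂ (t : ℝ) (X : Finset (Fin 6)) : ℝ :=
  if 4 ∈ X then 1 else if 3 ∈ X then t else 0

lemma reveals_layerRel₂ {α : Type*} [Fintype α] {p : α → ℝ} (hp : IsPMF p) {t : ℝ} (h0 : 0 ≤ t)
    (h1 : t ≤ 1) {X : Finset (Fin 6)} (hX : 4 ∈ X → 3 ∈ X) :
    Reveals (prodLaw (erased t p) p) (fun x => x.1.getD x.2) p (layerRel₂ X) (level₂ t X) := by
  have base := reveals_agreeIf hp (4 ∈ X)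
  by_cases h3 : 3 ∈ X
  · have e : level₂ t X = t + (1 - t) * if 4 ∈ X then 1 else 0 := by
      by_cases h4 : 4 ∈ X <;> simp [level₂, h3, h4]
    rw [e]
    exact base.erased hp.2 t h3
  · have h4 : 4 ∉ X := fun h => h3 (hX h)
    have e : level₂ t X = 0 := by simp [level₂, h3, h4]
    rw [e]
    exact reveals_false ((erased_isPMF h0 h1 hp).prodLaw hp).2
      (fun x x' => ⟨fun h => (h3 h).elim, fun h => (h4 h).elim⟩)
      (base.erased hp.2 t trivial).choose_spec.2.2.2

lemma reveals_layerRel₃ {α : Type*} [Fintype α] {p : α → ℝ} (hp : IsPMF p) {s t : ℝ} (hs : 0 ≤ s)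
    (hs' : s ≤ 1) (ht : 0 ≤ t) (ht' : t ≤ 1) {X : Finset (Fin 6)} (hX : 2 ∈ X → 1 ∈ X)
    (hX' : 1 ∈ X → 0 ∈ X) :
    Reveals (prodLaw (erased s p) (prodLaw (erased t p) p))
      (fun x => x.1.getD (x.2.1.getD x.2.2)) p (layerRel₃ X) (level₃ s (s + (1 - s) * t) X) := by
  have pmf := (erased_isPMF ht ht' hp).prodLaw hp
  have base : Reveals (prodLaw (erased t p) p) (fun x => x.1.getD x.2) p
      (fun x x' => agreeIf (1 ∈ X) x.1 x'.1 ∧ agreeIf (2 ∈ X) x.2 x'.2)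
      (if 2 ∈ X then 1 else if 1 ∈ X then t else 0) := by
    have base := reveals_agreeIf hp (2 ∈ X)
    by_cases h1 : 1 ∈ X
    · have e : (if 2 ∈ X then 1 else if 1 ∈ X then t else 0)
          = t + (1 - t) * if 2 ∈ X then 1 else 0 := by
        by_cases h2 : 2 ∈ X <;> simp [h1, h2]
      rw [e]
      exact base.erased hp.2 t h1
    · have h2 : 2 ∉ X := fun h => h1 (hX h)
      rw [if_neg h2, if_neg h1]
      exact reveals_false pmf.2 (fun x x' => ⟨fun h => (h1 h).elim, fun h => (h2 h).elim⟩)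
        (base.erased hp.2 t trivial).choose_spec.2.2.2
  by_cases h0 : 0 ∈ X
  · have e : level₃ s (s + (1 - s) * t) X
        = s + (1 - s) * if 2 ∈ X then 1 else if 1 ∈ X then t else 0 := by
      by_cases h2 : 2 ∈ X <;> by_cases h1 : 1 ∈ X <;> simp [level₃, h0, h1, h2]
    rw [e]
    exact base.erased pmf.2 s h0
  · have h1 : 1 ∉ X := fun h => h0 (hX' h)
    have h2 : 2 ∉ X := fun h => h1 (hX h)
    have e : level₃ s (s + (1 - s) * t) X = 0 := by simp [level₃, h0, h1, h2]
    rw [e]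
    exact reveals_false ((erased_isPMF hs hs' hp).prodLaw pmf).2
      (fun x x' => ⟨fun h => (h0 h).elim, fun h => (h1 h).elim, fun h => (h2 h).elim⟩)
      (base.erased pmf.2 s trivial).choose_spec.2.2.2

/-- The layer orders at one receiver: the three kinds of orders, where the cut of the first
message is either after its first layer or after its second one. -/
def layerOrder (early : Prop) : OrderKind → List (Fin 6)
  | .first => if early then [0, 3, 1, 2, 5, 4] else [0, 1, 3, 2, 5, 4]
  | .second => if early then [3, 5, 0, 4, 1, 2] else [3, 5, 0, 1, 4, 2]
  | .third => if early then [3, 0, 5, 1, 2, 4] else [3, 0, 1, 5, 2, 4]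

lemma SplitBounds.scBounds {h : Finset (Fin 6) → ℝ} {f : Prop → Prop → Prop → ℝ} {s s' t : ℝ}
    (hh : ∀ X : Finset (Fin 6), (2 ∈ X → 1 ∈ X) → (1 ∈ X → 0 ∈ X) → (4 ∈ X → 3 ∈ X) →
      h X = interp f (level₃ s s' X) (level₂ t X) (5 ∈ X))
    {early : Prop} {x y z : ℝ} {k : OrderKind}
    (hb : SplitBounds f (if early then s else s') t x y z k) :
    SCBounds h (layerOrder early k) x y z := by
  by_cases he : early <;> cases k <;> simp only [he, if_true, if_false] at hb <;>
    obtain ⟨b1, b2, b3⟩ := hb <;> refine ⟨b1.trans_eq ?_, b2.trans_eq ?_, b3.trans_eq ?_⟩ <;>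
    simp only [layerOrder, he, if_true, if_false, gain] <;>
    simp [hh, level₃, level₂] <;> ring

/-- Information about a variable with kernel `y` provided (up to an additive constant) by an
observation with kernel `r`. -/
def obsInfo {Ω : Type*} [Fintype Ω] (q : Ω → ℝ) (y r : Ω → Ω → Prop) : ℝ :=
  relEnt q r - relEnt q fun ω ω' => r ω ω' ∧ y ω ω'

lemma cmiOf_eq_obsInfo {Ω α β γ : Type*} [Fintype Ω] [Fintype α] [Fintype β] [Fintype γ]
    (q : Ω → ℝ) {A : Ω → α} {Y : Ω → β} {C : Ω → γ} {t s : Ω → Ω → Prop}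
    (ht : ∀ ω ω', (A ω = A ω' ∧ C ω = C ω') ↔ t ω ω') (hs : ∀ ω ω', C ω = C ω' ↔ s ω ω') :
    cmiOf q A Y C = obsInfo q (fun ω ω' => Y ω = Y ω') t
      - obsInfo q (fun ω ω' => Y ω = Y ω') s := by
  have h₁ : relEnt q (fun ω ω' => Y ω = Y ω' ∧ C ω = C ω')
      = relEnt q fun ω ω' => s ω ω' ∧ Y ω = Y ω' :=
    relEnt_congr q fun ω ω' => by rw [hs, and_comm]
  have h₂ : relEnt q (fun ω ω' => A ω = A ω' ∧ Y ω = Y ω' ∧ C ω = C ω')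
      = relEnt q fun ω ω' => t ω ω' ∧ Y ω = Y ω' :=
    relEnt_congr q fun ω ω' => by rw [← ht]; tauto
  simp only [cmiOf, obsInfo, Hof_eq_relEnt, Prod.mk.injEq, h₁, h₂, ht]
  simp only [hs]
  ring

lemma miOf_eq_obsInfo {Ω α β : Type*} [Fintype Ω] [Fintype α] [Fintype β]
    {q : Ω → ℝ} (hq : ∑ ω, q ω = 1) {A : Ω → α} {Y : Ω → β} {t s : Ω → Ω → Prop}
    (ht : ∀ ω ω', A ω = A ω' ↔ t ω ω') (hs : ∀ ω ω', s ω ω') :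
    miOf q A Y = obsInfo q (fun ω ω' => Y ω = Y ω') t
      - obsInfo q (fun ω ω' => Y ω = Y ω') s := by
  simp only [miOf, obsInfo, Hof_eq_relEnt, Prod.mk.injEq, ht, relEnt_of_total hq hs, hs, true_and]
  ring

lemma relEnt_of_marginal {Ω Ω' Z : Type*} [Fintype Ω] [Fintype Ω'] [Fintype Z] (e : Ω ≃ Ω' × Z)
    {q : Ω → ℝ} {L : Ω' → ℝ} (h : ∀ x, ∑ z, q (e.symm (x, z)) = L x) (r : Ω' → Ω' → Prop) :
    relEnt q (fun ω ω' => r (e ω).1 (e ω').1) = relEnt L r := by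
  rw [relEnt_equiv e]
  simp only [Equiv.apply_symm_apply]
  rw [relEnt_marginal (fun x => q (e.symm x)) r]
  simp only [h]

lemma obsInfo_eq_outEnt {Ω Z α β γ Y : Type*} [Fintype Ω] [Fintype Z] [Fintype α] [Fintype β]
    [Fintype γ] [Fintype Y] (e : Ω ≃ (α × β × γ × Y) × Z) {q : Ω → ℝ} {pA : α → ℝ} {pB : β → ℝ}
    {pC : γ → ℝ} {W : α → β → γ → Y → ℝ}
    (h : ∀ x, ∑ z, q (e.symm (x, z)) = macLaw pA pB pC W x)
    {y r : Ω → Ω → Prop} {a : α → α → Prop} {b : β → β → Prop} {c : γ → γ → Prop}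
    (hy : ∀ ω ω', y ω ω' ↔ (e ω).1.2.2.2 = (e ω').1.2.2.2)
    (hr : ∀ ω ω', r ω ω' ↔ a (e ω).1.1 (e ω').1.1 ∧ b (e ω).1.2.1 (e ω').1.2.1 ∧
      c (e ω).1.2.2.1 (e ω').1.2.2.1) :
    obsInfo q y r = -outEnt pA pB pC W a b c := by
  rw [obsInfo, outEnt, ← relEnt_of_marginal e h, ← relEnt_of_marginal e h, neg_sub]
  congr 1 <;> refine relEnt_congr q fun ω ω' => ?_
  · simp [hr, macRel, agreeIf]
  · simp only [hr, hy, macRel, agreeIf, forall_const]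
    tauto

/-- Effective channel seen by receiver 1. -/
def chan₁ (pV : 𝒱 → ℝ) (fx : 𝒮 → 𝒯 → 𝒳) (fw : 𝒰 → 𝒱 → 𝒲) (ch : 𝒳 → 𝒲 → 𝒴₁ → 𝒴₂ → ℝ)
    (s : 𝒮) (t : 𝒯) (u : 𝒰) (y : 𝒴₁) : ℝ :=
  ∑ v, pV v * ∑ y', ch (fx s t) (fw u v) y y'

/-- Effective channel seen by receiver 2. -/
def chan₂ (pT : 𝒯 → ℝ) (fx : 𝒮 → 𝒯 → 𝒳) (fw : 𝒰 → 𝒱 → 𝒲) (ch : 𝒳 → 𝒲 → 𝒴₁ → 𝒴₂ → ℝ)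
    (s : 𝒮) (v : 𝒱) (u : 𝒰) (y : 𝒴₂) : ℝ :=
  ∑ t, pT t * ∑ y', ch (fx s t) (fw u v) y' y

lemma chan₁_isPMF {pV : 𝒱 → ℝ} (hV : IsPMF pV) {fx : 𝒮 → 𝒯 → 𝒳} {fw : 𝒰 → 𝒱 → 𝒲}
    {ch : 𝒳 → 𝒲 → 𝒴₁ → 𝒴₂ → ℝ} (hch0 : ∀ x w y₁ y₂, 0 ≤ ch x w y₁ y₂)
    (hch1 : ∀ x w, ∑ y₁, ∑ y₂, ch x w y₁ y₂ = 1) (s : 𝒮) (t : 𝒯) (u : 𝒰) :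
    IsPMF (chan₁ pV fx fw ch s t u) := by
  refine ⟨fun y => Finset.sum_nonneg fun v _ => mul_nonneg (hV.1 v)
    (Finset.sum_nonneg fun _ _ => hch0 _ _ _ _), ?_⟩
  simp only [chan₁]
  rw [Finset.sum_comm]
  simp only [← Finset.mul_sum, hch1, mul_one, hV.2]

lemma chan₂_isPMF {pT : 𝒯 → ℝ} (hT : IsPMF pT) {fx : 𝒮 → 𝒯 → 𝒳} {fw : 𝒰 → 𝒱 → 𝒲}
    {ch : 𝒳 → 𝒲 → 𝒴₁ → 𝒴₂ → ℝ} (hch0 : ∀ x w y₁ y₂, 0 ≤ ch x w y₁ y₂)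
    (hch1 : ∀ x w, ∑ y₁, ∑ y₂, ch x w y₁ y₂ = 1) (s : 𝒮) (v : 𝒱) (u : 𝒰) :
    IsPMF (chan₂ pT fx fw ch s v u) := by
  refine ⟨fun y => Finset.sum_nonneg fun v _ => mul_nonneg (hT.1 v)
    (Finset.sum_nonneg fun _ _ => hch0 _ _ _ _), ?_⟩
  have h (t : 𝒯) : ∑ y, ∑ y', ch (fx s t) (fw u v) y' y = 1 := by
    rw [Finset.sum_comm, hch1]
  simp only [chan₂]
  rw [Finset.sum_comm]
  simp only [← Finset.mul_sum, h, mul_one, hT.2]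

lemma hkBaseJoint_sum {pS : 𝒮 → ℝ} {pT : 𝒯 → ℝ} {pU : 𝒰 → ℝ} {pV : 𝒱 → ℝ} (hS : IsPMF pS)
    (hT : IsPMF pT) (hU : IsPMF pU) (hV : IsPMF pV) {fx : 𝒮 → 𝒯 → 𝒳} {fw : 𝒰 → 𝒱 → 𝒲}
    {ch : 𝒳 → 𝒲 → 𝒴₁ → 𝒴₂ → ℝ} (hch1 : ∀ x w, ∑ y₁, ∑ y₂, ch x w y₁ y₂ = 1) :
    ∑ ω, hkBaseJoint pS pT pU pV fx fw ch ω = 1 := by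
  simp only [hkBaseJoint, Fintype.sum_prod_type, ← Finset.mul_sum, hch1, mul_one, hS.2, hT.2,
    hU.2, hV.2]

lemma hkJoint_sum {pU : 𝒰 → ℝ} (hU : IsPMF pU) {fx : 𝒮 → 𝒯 → 𝒳} {fw : 𝒰 → 𝒱 → 𝒲}
    {ch : 𝒳 → 𝒲 → 𝒴₁ → 𝒴₂ → ℝ} (hch1 : ∀ x w, ∑ y₁, ∑ y₂, ch x w y₁ y₂ = 1)
    (s : HKSplit 𝒮 𝒯 𝒰 𝒱) : ∑ ω, hkJoint fx fw s pU ch ω = 1 := by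
  simp only [hkJoint, Fintype.sum_prod_type, ← Finset.mul_sum, hch1, mul_one, hU.2,
    s.pS1_pmf.2, s.pS2_pmf.2, s.pS3_pmf.2, s.pT1_pmf.2, s.pT2_pmf.2, s.pV1_pmf.2, s.pV2_pmf.2]

lemma obsInfo_hkBaseJoint₁ (pS : 𝒮 → ℝ) (pT : 𝒯 → ℝ) (pU : 𝒰 → ℝ) (pV : 𝒱 → ℝ)
    (fx : 𝒮 → 𝒯 → 𝒳) (fw : 𝒰 → 𝒱 → 𝒲) (ch : 𝒳 → 𝒲 → 𝒴₁ → 𝒴₂ → ℝ) (a b c : Prop) :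
    obsInfo (hkBaseJoint pS pT pU pV fx fw ch) (fun ω ω' => ω.2.2.2.2.1 = ω'.2.2.2.2.1)
        (fun ω ω' => agreeIf a ω.1 ω'.1 ∧ agreeIf b ω.2.1 ω'.2.1 ∧ agreeIf c ω.2.2.1 ω'.2.2.1)
      = macInfo pS pT pU (chan₁ pV fx fw ch) a b c := by
  let e : 𝒮 × 𝒯 × 𝒰 × 𝒱 × 𝒴₁ × 𝒴₂ ≃ (𝒮 × 𝒯 × 𝒰 × 𝒴₁) × 𝒱 × 𝒴₂ :=
    ⟨fun ω => ((ω.1, ω.2.1, ω.2.2.1, ω.2.2.2.2.1), ω.2.2.2.1, ω.2.2.2.2.2),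
      fun x => (x.1.1, x.1.2.1, x.1.2.2.1, x.2.1, x.1.2.2.2, x.2.2), fun _ => rfl, fun _ => rfl⟩
  refine obsInfo_eq_outEnt e (fun x => ?_) (fun _ _ => Iff.rfl) fun _ _ => Iff.rfl
  simp only [e, Equiv.coe_fn_symm_mk, hkBaseJoint, macLaw, chan₁, Fintype.sum_prod_type,
    Finset.mul_sum, mul_assoc]

lemma obsInfo_hkBaseJoint₂ (pS : 𝒮 → ℝ) (pT : 𝒯 → ℝ) (pU : 𝒰 → ℝ) (pV : 𝒱 → ℝ)
    (fx : 𝒮 → 𝒯 → 𝒳) (fw : 𝒰 → 𝒱 → 𝒲) (ch : 𝒳 → 𝒲 → 𝒴₁ → 𝒴₂ → ℝ) (a b c : Prop) :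
    obsInfo (hkBaseJoint pS pT pU pV fx fw ch) (fun ω ω' => ω.2.2.2.2.2 = ω'.2.2.2.2.2)
        (fun ω ω' => agreeIf a ω.1 ω'.1 ∧ agreeIf b ω.2.2.2.1 ω'.2.2.2.1 ∧
          agreeIf c ω.2.2.1 ω'.2.2.1)
      = macInfo pS pV pU (chan₂ pT fx fw ch) a b c := by
  let e : 𝒮 × 𝒯 × 𝒰 × 𝒱 × 𝒴₁ × 𝒴₂ ≃ (𝒮 × 𝒱 × 𝒰 × 𝒴₂) × 𝒯 × 𝒴₁ :=
    ⟨fun ω => ((ω.1, ω.2.2.2.1, ω.2.2.1, ω.2.2.2.2.2), ω.2.1, ω.2.2.2.2.1),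
      fun x => (x.1.1, x.2.1, x.1.2.2.1, x.1.2.1, x.2.2, x.1.2.2.2), fun _ => rfl, fun _ => rfl⟩
  refine obsInfo_eq_outEnt e (fun x => ?_) (fun _ _ => Iff.rfl) fun _ _ => Iff.rfl
  simp only [e, Equiv.coe_fn_symm_mk, hkBaseJoint, macLaw, chan₂, Fintype.sum_prod_type,
    Finset.mul_sum]
  refine Finset.sum_congr rfl fun _ _ => Finset.sum_congr rfl fun _ _ => ?_
  ring

lemma sum_mul_comp_of_pushf {Ω α : Type*} [Fintype Ω] [Fintype α] {P : Ω → ℝ} {g : Ω → α}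
    {p : α → ℝ} (h : ∀ a, pushf P g a = p a) (k : α → ℝ) :
    ∑ x, P x * k (g x) = ∑ a, p a * k a := by
  simp only [← h, pushf, Finset.sum_mul, ite_mul, zero_mul]
  rw [Finset.sum_comm]
  simp

/-- Agreement of the layers selected by `X`, the layers `0, …, 5` being the given variables. -/
def layerObs {Ω A B C D E F : Type*} (a : Ω → A) (b : Ω → B) (c : Ω → C) (d : Ω → D)
    (f : Ω → E) (u : Ω → F) (X : Finset (Fin 6)) (ω ω' : Ω) : Prop :=
  (agreeIf (0 ∈ X) (a ω) (a ω') ∧ agreeIf (1 ∈ X) (b ω) (b ω') ∧ agreeIf (2 ∈ X) (c ω) (c ω')) ∧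
    (agreeIf (3 ∈ X) (d ω) (d ω') ∧ agreeIf (4 ∈ X) (f ω) (f ω')) ∧ agreeIf (5 ∈ X) (u ω) (u ω')

/-- Information on the output of receiver 1 carried by its layers. -/
def splitInfo₁ (fx : 𝒮 → 𝒯 → 𝒳) (fw : 𝒰 → 𝒱 → 𝒲) (s : HKSplit 𝒮 𝒯 𝒰 𝒱) (pU : 𝒰 → ℝ)
    (ch : 𝒳 → 𝒲 → 𝒴₁ → 𝒴₂ → ℝ) (X : Finset (Fin 6)) : ℝ :=
  obsInfo (hkJoint fx fw s pU ch)
    (fun ω ω' => ω.2.2.2.2.2.2.2.2.1 = ω'.2.2.2.2.2.2.2.2.1)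
    (layerObs (fun ω => ω.1) (fun ω => ω.2.1) (fun ω => ω.2.2.1) (fun ω => ω.2.2.2.1)
      (fun ω => ω.2.2.2.2.1) (fun ω => ω.2.2.2.2.2.1) X)

/-- Information on the output of receiver 2 carried by its layers. -/
def splitInfo₂ (fx : 𝒮 → 𝒯 → 𝒳) (fw : 𝒰 → 𝒱 → 𝒲) (s : HKSplit 𝒮 𝒯 𝒰 𝒱) (pU : 𝒰 → ℝ)
    (ch : 𝒳 → 𝒲 → 𝒴₁ → 𝒴₂ → ℝ) (X : Finset (Fin 6)) : ℝ :=
  obsInfo (hkJoint fx fw s pU ch)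
    (fun ω ω' => ω.2.2.2.2.2.2.2.2.2 = ω'.2.2.2.2.2.2.2.2.2)
    (layerObs (fun ω => ω.1) (fun ω => ω.2.1) (fun ω => ω.2.2.1) (fun ω => ω.2.2.2.2.2.2.1)
      (fun ω => ω.2.2.2.2.2.2.2.1) (fun ω => ω.2.2.2.2.2.1) X)

lemma splitInfo₁_eq {pS : 𝒮 → ℝ} {pT : 𝒯 → ℝ} {pV : 𝒱 → ℝ} {s : HKSplit 𝒮 𝒯 𝒰 𝒱}
    (hs : s.Matches pS pT pV) (fx : 𝒮 → 𝒯 → 𝒳) (fw : 𝒰 → 𝒱 → 𝒲) (pU : 𝒰 → ℝ)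
    (ch : 𝒳 → 𝒲 → 𝒴₁ → 𝒴₂ → ℝ) (X : Finset (Fin 6)) :
    splitInfo₁ fx fw s pU ch X
      = layerInfo (prodLaw s.pS1 (prodLaw s.pS2 s.pS3)) (prodLaw s.pT1 s.pT2) pU
        (fun x y => chan₁ pV fx fw ch (s.fs x.1 x.2.1 x.2.2) (s.ft y.1 y.2)) X := by
  let e : s.S1 × s.S2 × s.S3 × s.T1 × s.T2 × 𝒰 × s.V1 × s.V2 × 𝒴₁ × 𝒴₂ ≃
      ((s.S1 × s.S2 × s.S3) × (s.T1 × s.T2) × 𝒰 × 𝒴₁) × (s.V1 × s.V2) × 𝒴₂ :=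
    ⟨fun ω => (((ω.1, ω.2.1, ω.2.2.1), (ω.2.2.2.1, ω.2.2.2.2.1), ω.2.2.2.2.2.1,
        ω.2.2.2.2.2.2.2.2.1), (ω.2.2.2.2.2.2.1, ω.2.2.2.2.2.2.2.1), ω.2.2.2.2.2.2.2.2.2),
      fun x => (x.1.1.1, x.1.1.2.1, x.1.1.2.2, x.1.2.1.1, x.1.2.1.2, x.1.2.2.1, x.2.1.1, x.2.1.2,
        x.1.2.2.2, x.2.2), fun _ => rfl, fun _ => rfl⟩
  refine obsInfo_eq_outEnt e (fun x => ?_) (fun _ _ => Iff.rfl) fun _ _ => Iff.rfl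
  simp only [chan₁, macLaw, ← sum_mul_comp_of_pushf hs.2.2]
  rw [Fintype.sum_prod_type]
  simp only [e, Equiv.coe_fn_symm_mk, hkJoint, prodLaw, Finset.mul_sum]
  refine Finset.sum_congr rfl fun _ _ => Finset.sum_congr rfl fun _ _ => ?_
  ring

lemma splitInfo₂_eq {pS : 𝒮 → ℝ} {pT : 𝒯 → ℝ} {pV : 𝒱 → ℝ} {s : HKSplit 𝒮 𝒯 𝒰 𝒱}
    (hs : s.Matches pS pT pV) (fx : 𝒮 → 𝒯 → 𝒳) (fw : 𝒰 → 𝒱 → 𝒲) (pU : 𝒰 → ℝ)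
    (ch : 𝒳 → 𝒲 → 𝒴₁ → 𝒴₂ → ℝ) (X : Finset (Fin 6)) :
    splitInfo₂ fx fw s pU ch X
      = layerInfo (prodLaw s.pS1 (prodLaw s.pS2 s.pS3)) (prodLaw s.pV1 s.pV2) pU
        (fun x y => chan₂ pT fx fw ch (s.fs x.1 x.2.1 x.2.2) (s.fv y.1 y.2)) X := by
  let e : s.S1 × s.S2 × s.S3 × s.T1 × s.T2 × 𝒰 × s.V1 × s.V2 × 𝒴₁ × 𝒴₂ ≃
      ((s.S1 × s.S2 × s.S3) × (s.V1 × s.V2) × 𝒰 × 𝒴₂) × (s.T1 × s.T2) × 𝒴₁ :=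
    ⟨fun ω => (((ω.1, ω.2.1, ω.2.2.1), (ω.2.2.2.2.2.2.1, ω.2.2.2.2.2.2.2.1), ω.2.2.2.2.2.1,
        ω.2.2.2.2.2.2.2.2.2), (ω.2.2.2.1, ω.2.2.2.2.1), ω.2.2.2.2.2.2.2.2.1),
      fun x => (x.1.1.1, x.1.1.2.1, x.1.1.2.2, x.2.1.1, x.2.1.2, x.1.2.2.1, x.1.2.1.1, x.1.2.1.2,
        x.2.2, x.1.2.2.2), fun _ => rfl, fun _ => rfl⟩
  refine obsInfo_eq_outEnt e (fun x => ?_) (fun _ _ => Iff.rfl) fun _ _ => Iff.rfl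
  simp only [chan₂, macLaw, ← sum_mul_comp_of_pushf hs.2.1]
  rw [Fintype.sum_prod_type]
  simp only [e, Equiv.coe_fn_symm_mk, hkJoint, prodLaw, Finset.mul_sum]
  refine Finset.sum_congr rfl fun _ _ => Finset.sum_congr rfl fun _ _ => ?_
  ring

lemma le_iff_of_eq_right {a b c : ℝ} (h : b = c) : a ≤ b ↔ a ≤ c := by rw [h]

lemma mem_R1MACHK_iff {pS : 𝒮 → ℝ} {pT : 𝒯 → ℝ} {pU : 𝒰 → ℝ} {pV : 𝒱 → ℝ} (hS : IsPMF pS)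
    (hT : IsPMF pT) (hU : IsPMF pU) (hV : IsPMF pV) {fx : 𝒮 → 𝒯 → 𝒳} {fw : 𝒰 → 𝒱 → 𝒲}
    {ch : 𝒳 → 𝒲 → 𝒴₁ → 𝒴₂ → ℝ} (hch1 : ∀ x w, ∑ y₁, ∑ y₂, ch x w y₁ y₂ = 1)
    (r : ℝ × ℝ × ℝ × ℝ) :
    r ∈ R1MACHK pS pT pU pV fx fw ch ↔ (0 ≤ r.1 ∧ 0 ≤ r.2.1 ∧ 0 ≤ r.2.2.1 ∧ 0 ≤ r.2.2.2) ∧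
      MACBounds (macInfo pS pT pU (chan₁ pV fx fw ch)) r.1 r.2.1 r.2.2.1 := by
  simp only [R1MACHK, MACBounds, Set.mem_ofPred_eq, and_assoc, ← obsInfo_hkBaseJoint₁]
  refine and_congr_right' <| and_congr_right' <| and_congr_right' <| and_congr_right' ?_
  repeat' refine and_congr ?_ ?_
  all_goals
    refine le_iff_of_eq_right ?_
    first
    | refine cmiOf_eq_obsInfo _ (fun ω ω' => ?_) fun ω ω' => ?_
    | refine miOf_eq_obsInfo (hkBaseJoint_sum hS hT hU hV hch1) (fun ω ω' => ?_) fun ω ω' => ?_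
    all_goals
      simp only [agreeIf, Prod.mk.injEq]
      tauto

lemma mem_R2MACHK_iff {pS : 𝒮 → ℝ} {pT : 𝒯 → ℝ} {pU : 𝒰 → ℝ} {pV : 𝒱 → ℝ} (hS : IsPMF pS)
    (hT : IsPMF pT) (hU : IsPMF pU) (hV : IsPMF pV) {fx : 𝒮 → 𝒯 → 𝒳} {fw : 𝒰 → 𝒱 → 𝒲}
    {ch : 𝒳 → 𝒲 → 𝒴₁ → 𝒴₂ → ℝ} (hch1 : ∀ x w, ∑ y₁, ∑ y₂, ch x w y₁ y₂ = 1)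
    (r : ℝ × ℝ × ℝ × ℝ) :
    r ∈ R2MACHK pS pT pU pV fx fw ch ↔ (0 ≤ r.1 ∧ 0 ≤ r.2.1 ∧ 0 ≤ r.2.2.1 ∧ 0 ≤ r.2.2.2) ∧
      MACBounds (macInfo pS pV pU (chan₂ pT fx fw ch)) r.1 r.2.2.2 r.2.2.1 := by
  have swap (a b c d e f g : Prop) :
      a ∧ b ∧ c ∧ d ∧ e ∧ f ∧ g ↔ a ∧ c ∧ b ∧ e ∧ d ∧ f ∧ g := by tauto
  simp only [R2MACHK, MACBounds, Set.mem_ofPred_eq, and_assoc, ← obsInfo_hkBaseJoint₂]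
  refine and_congr_right' <| and_congr_right' <| and_congr_right' <| and_congr_right' ?_
  rw [swap, add_comm r.2.2.1, add_right_comm]
  repeat' refine and_congr ?_ ?_
  all_goals
    refine le_iff_of_eq_right ?_
    first
    | refine cmiOf_eq_obsInfo _ (fun ω ω' => ?_) fun ω ω' => ?_
    | refine miOf_eq_obsInfo (hkBaseJoint_sum hS hT hU hV hch1) (fun ω ω' => ?_) fun ω ω' => ?_
    all_goals
      simp only [agreeIf, Prod.mk.injEq]
      tauto

/-- The order in which receiver 1 decodes its layers. -/
def HKOrder1.layers : HKOrder1 → List (Fin 6)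
  | .o1 => layerOrder True .first
  | .o2 => layerOrder True .second
  | .o3 => layerOrder True .third
  | .o4 => layerOrder False .first
  | .o5 => layerOrder False .second
  | .o6 => layerOrder False .third

/-- The order in which receiver 2 decodes its layers. -/
def HKOrder2.layers : HKOrder2 → List (Fin 6)
  | .o7 => layerOrder True .first
  | .o8 => layerOrder True .second
  | .o9 => layerOrder True .third
  | .o10 => layerOrder False .first
  | .o11 => layerOrder False .second
  | .o12 => layerOrder False .third

lemma agreeIf_mem_insert {α : Type*} (i j : Fin 6) (X : Finset (Fin 6)) (x x' : α) :
    agreeIf (i ∈ insert j X) x x' ↔ (i = j → x = x') ∧ agreeIf (i ∈ X) x x' := by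
  simp [agreeIf, or_imp]

lemma agreeIf_mem_empty {α : Type*} (i : Fin 6) (x x' : α) :
    agreeIf (i ∈ (∅ : Finset (Fin 6))) x x' ↔ True := by
  simp [agreeIf]

lemma mem_R1Reg_iff {pU : 𝒰 → ℝ} (hU : IsPMF pU) {fx : 𝒮 → 𝒯 → 𝒳} {fw : 𝒰 → 𝒱 → 𝒲}
    {ch : 𝒳 → 𝒲 → 𝒴₁ → 𝒴₂ → ℝ} (hch1 : ∀ x w, ∑ y₁, ∑ y₂, ch x w y₁ y₂ = 1)
    (s : HKSplit 𝒮 𝒯 𝒰 𝒱) (o : HKOrder1) (r : ℝ × ℝ × ℝ × ℝ) :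
    r ∈ R1Reg fx fw s pU ch o ↔ (0 ≤ r.1 ∧ 0 ≤ r.2.1 ∧ 0 ≤ r.2.2.1 ∧ 0 ≤ r.2.2.2) ∧
      SCBounds (splitInfo₁ fx fw s pU ch) o.layers r.1 r.2.1 r.2.2.1 := by
  cases o
  all_goals
    simp only [R1Reg, R1L1, R1L2, R1L3, R1L4, R1L5, R1L6, HKOrder1.layers, layerOrder, if_true,
      if_false, SCBounds, gain, Set.mem_ofPred_eq, and_assoc]
    refine and_congr_right' <| and_congr_right' <| and_congr_right' <| and_congr_right' ?_
    simp +decide only [if_true, if_false, zero_add, add_zero, ← add_assoc]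
    refine and_congr ?_ (and_congr ?_ ?_) <;> refine le_iff_of_eq_right ?_
    all_goals
      repeat' with_reducible refine congrArg₂ (· + ·) ?_ ?_
    all_goals
      first
      | refine cmiOf_eq_obsInfo _ (fun ω ω' => ?_) fun ω ω' => ?_
      | refine miOf_eq_obsInfo (hkJoint_sum hU hch1 s) (fun ω ω' => ?_) fun ω ω' => ?_
      all_goals
        simp only [layerObs, agreeIf_mem_insert, agreeIf_mem_empty, Fin.reduceEq, Prod.mk.injEq,
          forall_const, false_imp_iff, true_and, and_true]
        try exact ⟨fun h => by simp only [h, and_self], fun h => by simp only [h, and_self]⟩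

lemma mem_R2Reg_iff {pU : 𝒰 → ℝ} (hU : IsPMF pU) {fx : 𝒮 → 𝒯 → 𝒳} {fw : 𝒰 → 𝒱 → 𝒲}
    {ch : 𝒳 → 𝒲 → 𝒴₁ → 𝒴₂ → ℝ} (hch1 : ∀ x w, ∑ y₁, ∑ y₂, ch x w y₁ y₂ = 1)
    (s : HKSplit 𝒮 𝒯 𝒰 𝒱) (o : HKOrder2) (r : ℝ × ℝ × ℝ × ℝ) :
    r ∈ R2Reg fx fw s pU ch o ↔ (0 ≤ r.1 ∧ 0 ≤ r.2.1 ∧ 0 ≤ r.2.2.1 ∧ 0 ≤ r.2.2.2) ∧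
      SCBounds (splitInfo₂ fx fw s pU ch) o.layers r.1 r.2.2.2 r.2.2.1 := by
  cases o
  all_goals
    simp only [R2Reg, R2L7, R2L8, R2L9, R2L10, R2L11, R2L12, HKOrder2.layers, layerOrder, if_true,
      if_false, SCBounds, gain, Set.mem_ofPred_eq, and_assoc]
    refine and_congr_right' <| and_congr_right' <| and_congr_right' <| and_congr_right' ?_
    simp +decide only [if_true, if_false, zero_add, add_zero, ← add_assoc]
    refine and_congr ?_ (and_congr ?_ ?_) <;> refine le_iff_of_eq_right ?_
    all_goals
      repeat' with_reducible refine congrArg₂ (· + ·) ?_ ?_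
    all_goals
      first
      | refine cmiOf_eq_obsInfo _ (fun ω ω' => ?_) fun ω ω' => ?_
      | refine miOf_eq_obsInfo (hkJoint_sum hU hch1 s) (fun ω ω' => ?_) fun ω ω' => ?_
      all_goals
        simp only [layerObs, agreeIf_mem_insert, agreeIf_mem_empty, Fin.reduceEq, Prod.mk.injEq,
          forall_const, false_imp_iff, true_and, and_true]
        try exact ⟨fun h => by simp only [h, and_self], fun h => by simp only [h, and_self]⟩

lemma HKOrder1.toFinset_layers (o : HKOrder1) : o.layers.toFinset = Finset.univ := by
  cases o <;> simp only [layers, layerOrder, if_true, if_false] <;> decide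

lemma HKOrder2.toFinset_layers (o : HKOrder2) : o.layers.toFinset = Finset.univ := by
  cases o <;> simp only [layers, layerOrder, if_true, if_false] <;> decide

lemma HKOrder1.exists_layers_eq (early : Prop) (k : OrderKind) :
    ∃ o : HKOrder1, o.layers = layerOrder early k := by
  by_cases he : early <;> cases k <;> simp only [he]
  exacts [⟨.o1, rfl⟩, ⟨.o2, rfl⟩, ⟨.o3, rfl⟩, ⟨.o4, rfl⟩, ⟨.o5, rfl⟩, ⟨.o6, rfl⟩]

lemma HKOrder2.exists_layers_eq (early : Prop) (k : OrderKind) :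
    ∃ o : HKOrder2, o.layers = layerOrder early k := by
  by_cases he : early <;> cases k <;> simp only [he]
  exacts [⟨.o7, rfl⟩, ⟨.o8, rfl⟩, ⟨.o9, rfl⟩, ⟨.o10, rfl⟩, ⟨.o11, rfl⟩, ⟨.o12, rfl⟩]

lemma Reveals.sum_mul_comp {Ω α : Type*} [Fintype Ω] [Fintype α] {P : Ω → ℝ} {g : Ω → α}
    {p : α → ℝ} {r : Ω → Ω → Prop} {ε : ℝ} (h : Reveals P g p r ε) (k : α → ℝ) :
    ∑ x, P x * k (g x) = ∑ a, p a * k a :=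
  h.choose_spec.2.2.2 k

lemma Reveals.pushf_eq {Ω α : Type*} [Fintype Ω] [Fintype α] {P : Ω → ℝ} {g : Ω → α}
    {p : α → ℝ} {r : Ω → Ω → Prop} {ε : ℝ} (h : Reveals P g p r ε) (a : α) :
    pushf P g a = p a := by
  simpa [pushf] using h.sum_mul_comp fun b => if b = a then 1 else 0

section Blocks

variable {A B C D E α β γ Y : Type*} [Fintype A] [Fintype B] [Fintype C] [Fintype D] [Fintype E]
  [Fintype α] [Fintype β] [Fintype γ] [Fintype Y]

lemma reveals_layerRel₃_of_block {P : A × B × C → ℝ} (hP : ∑ x, P x = 1) {g : A × B × C → α}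
    {p : α → ℝ} (hg : ∀ k : α → ℝ, ∑ x, P x * k (g x) = ∑ a, p a * k a) {X : Finset (Fin 6)}
    (h₁ : 0 ∈ X ↔ 1 ∈ X) (h₂ : 0 ∈ X ↔ 2 ∈ X) :
    Reveals P g p (layerRel₃ X) (if 0 ∈ X then 1 else 0) := by
  by_cases h : 0 ∈ X
  · rw [if_pos h]
    refine reveals_true (fun x x' hx => congrArg g ?_) hg
    exact (Prod.ext (hx.1 h) (Prod.ext (hx.2.1 (h₁.1 h)) (hx.2.2 (h₂.1 h)))).symm
  · rw [if_neg h]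
    exact reveals_false hP (fun _ _ => ⟨fun h' => (h h').elim, fun h' => (h (h₁.2 h')).elim,
      fun h' => (h (h₂.2 h')).elim⟩) hg

lemma reveals_layerRel₂_of_block {P : D × E → ℝ} (hP : ∑ x, P x = 1) {g : D × E → α}
    {p : α → ℝ} (hg : ∀ k : α → ℝ, ∑ x, P x * k (g x) = ∑ a, p a * k a) {X : Finset (Fin 6)}
    (h₁ : 3 ∈ X ↔ 4 ∈ X) : Reveals P g p (layerRel₂ X) (if 3 ∈ X then 1 else 0) := by
  by_cases h : 3 ∈ X
  · rw [if_pos h]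
    exact reveals_true (fun x x' hx => congrArg g (Prod.ext (hx.1 h) (hx.2 (h₁.1 h))).symm) hg
  · rw [if_neg h]
    exact reveals_false hP (fun _ _ => ⟨fun h' => (h h').elim, fun h' => (h (h₁.2 h')).elim⟩) hg

/-- Rates achieved by successive cancellation of layers are achieved by joint decoding. -/
lemma macBounds_of_scBounds_layerInfo {p₀ : A → ℝ} {p₁ : B → ℝ} {p₂ : C → ℝ} {p₃ : D → ℝ}
    {p₄ : E → ℝ} {pA : α → ℝ} {pB : β → ℝ} {pC : γ → ℝ} (h₀ : IsPMF p₀) (h₁ : IsPMF p₁)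
    (h₂ : IsPMF p₂) (h₃ : IsPMF p₃) (h₄ : IsPMF p₄) (hA : IsPMF pA) (hB : IsPMF pB)
    (hC : IsPMF pC) {W : α → β → γ → Y → ℝ} (hW : ∀ a b c, IsPMF (W a b c))
    {g : A × B × C → α} {g' : D × E → β}
    (hg : ∀ a, pushf (prodLaw p₀ (prodLaw p₁ p₂)) g a = pA a)
    (hg' : ∀ b, pushf (prodLaw p₃ p₄) g' b = pB b)
    {l : List (Fin 6)} (hl : l.toFinset = Finset.univ) {x y z : ℝ}
    (h : SCBounds (layerInfo (prodLaw p₀ (prodLaw p₁ p₂)) (prodLaw p₃ p₄) pC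
      fun x y => W (g x) (g' y)) l x y z) :
    MACBounds (macInfo pA pB pC W) x y z := by
  have hP := h₀.prodLaw (h₁.prodLaw h₂)
  have hP' := h₃.prodLaw h₄
  refine SCBounds.macBounds
    (layerInfo_supermodular h₀ h₁ h₂ h₃ h₄ hC fun _ _ _ => hW _ _ _) (fun X e₁ e₂ e₃ => ?_) hl h
  rw [layerInfo_eq_interp hP hP' hA hB hC hW
    (reveals_layerRel₃_of_block hP.2 (sum_mul_comp_of_pushf hg) e₁ e₂)
    (reveals_layerRel₂_of_block hP'.2 (sum_mul_comp_of_pushf hg') e₃)]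
  by_cases h0 : 0 ∈ X <;> by_cases h3 : 3 ∈ X <;> simp [interp, h0, h3]

/-- Layers obtained by erasure achieve the rates attained by cutting the messages at the
corresponding levels. -/
lemma SplitBounds.scBounds_layerInfo {pA : α → ℝ} {pB : β → ℝ} {pC : γ → ℝ} (hA : IsPMF pA)
    (hB : IsPMF pB) (hC : IsPMF pC) {W : α → β → γ → Y → ℝ} (hW : ∀ a b c, IsPMF (W a b c))
    {s t τ : ℝ} (hs : s ∈ Set.Icc 0 1) (ht : t ∈ Set.Icc 0 1) (hτ : τ ∈ Set.Icc 0 1)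
    {early : Prop} {x y z : ℝ} {k : OrderKind}
    (h : SplitBounds (macInfo pA pB pC W) (if early then s else s + (1 - s) * t) τ x y z k) :
    SCBounds (layerInfo (prodLaw (erased s pA) (prodLaw (erased t pA) pA))
      (prodLaw (erased τ pB) pB) pC fun x y => W (x.1.getD (x.2.1.getD x.2.2)) (y.1.getD y.2))
      (layerOrder early k) x y z := by
  refine SplitBounds.scBounds (fun X e₁ e₂ e₃ => ?_) h
  exact layerInfo_eq_interp
    ((erased_isPMF hs.1 hs.2 hA).prodLaw ((erased_isPMF ht.1 ht.2 hA).prodLaw hA))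
    ((erased_isPMF hτ.1 hτ.2 hB).prodLaw hB) hA hB hC hW
    (reveals_layerRel₃ hA hs.1 hs.2 ht.1 ht.2 e₁ e₂) (reveals_layerRel₂ hB hτ.1 hτ.2 e₃)

end Blocks

lemma exists_levels {a b : ℝ} (ha : a ∈ Set.Icc (0 : ℝ) 1) (hb : b ∈ Set.Icc (0 : ℝ) 1) :
    ∃ s ∈ Set.Icc (0 : ℝ) 1, ∃ t ∈ Set.Icc (0 : ℝ) 1, ∃ early early' : Prop,
      a = (if early then s else s + (1 - s) * t) ∧
      b = if early' then s else s + (1 - s) * t := by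
  rcases le_total a b with h | h
  · obtain ⟨t, h0, h1, ht⟩ := exists_affine_eq h hb.2
    refine ⟨a, ha, t, ⟨h0, h1⟩, True, False, by simp, ?_⟩
    rw [if_neg id]
    linarith
  · obtain ⟨t, h0, h1, ht⟩ := exists_affine_eq h ha.2
    refine ⟨b, hb, t, ⟨h0, h1⟩, False, True, ?_, by simp⟩
    rw [if_neg id]
    linarith

/-- The split whose layers are erased copies of the messages, revealed one after the other. -/
def HKSplit.ofErased {pS : 𝒮 → ℝ} {pT : 𝒯 → ℝ} {pV : 𝒱 → ℝ} (hS : IsPMF pS) (hT : IsPMF pT)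
    (hV : IsPMF pV) {s t τ ν : ℝ} (hs : s ∈ Set.Icc 0 1) (ht : t ∈ Set.Icc 0 1)
    (hτ : τ ∈ Set.Icc 0 1) (hν : ν ∈ Set.Icc 0 1) : HKSplit 𝒮 𝒯 𝒰 𝒱 where
  S1 := Option 𝒮
  S2 := Option 𝒮
  S3 := 𝒮
  T1 := Option 𝒯
  T2 := 𝒯
  V1 := Option 𝒱
  V2 := 𝒱
  pS1 := erased s pS
  pS2 := erased t pS
  pS3 := pS
  pT1 := erased τ pT
  pT2 := pT
  pV1 := erased ν pV
  pV2 := pV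
  fs a b c := a.getD (b.getD c)
  ft := Option.getD
  fv := Option.getD
  pS1_pmf := erased_isPMF hs.1 hs.2 hS
  pS2_pmf := erased_isPMF ht.1 ht.2 hS
  pS3_pmf := hS
  pT1_pmf := erased_isPMF hτ.1 hτ.2 hT
  pT2_pmf := hT
  pV1_pmf := erased_isPMF hν.1 hν.2 hV
  pV2_pmf := hV

lemma HKSplit.matches_iff (s : HKSplit 𝒮 𝒯 𝒰 𝒱) (pS : 𝒮 → ℝ) (pT : 𝒯 → ℝ) (pV : 𝒱 → ℝ) :
    s.Matches pS pT pV ↔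
      (∀ a, pushf (prodLaw s.pS1 (prodLaw s.pS2 s.pS3)) (fun x => s.fs x.1 x.2.1 x.2.2) a
        = pS a) ∧
      (∀ a, pushf (prodLaw s.pT1 s.pT2) (fun x => s.ft x.1 x.2) a = pT a) ∧
      ∀ a, pushf (prodLaw s.pV1 s.pV2) (fun x => s.fv x.1 x.2) a = pV a := by
  simp only [Matches, mul_assoc]
  rfl

lemma HKSplit.matches_ofErased {pS : 𝒮 → ℝ} {pT : 𝒯 → ℝ} {pV : 𝒱 → ℝ} (hS : IsPMF pS)
    (hT : IsPMF pT) (hV : IsPMF pV) {s t τ ν : ℝ} (hs : s ∈ Set.Icc 0 1) (ht : t ∈ Set.Icc 0 1)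
    (hτ : τ ∈ Set.Icc 0 1) (hν : ν ∈ Set.Icc 0 1) :
    (ofErased hS hT hV hs ht hτ hν : HKSplit 𝒮 𝒯 𝒰 𝒱).Matches pS pT pV := by
  rw [matches_iff]
  exact ⟨(reveals_layerRel₃ (X := Finset.univ) hS hs.1 hs.2 ht.1 ht.2 (by simp)
      (by simp)).pushf_eq,
    (reveals_layerRel₂ (X := Finset.univ) hT hτ.1 hτ.2 (by simp)).pushf_eq,
    (reveals_layerRel₂ (X := Finset.univ) hV hν.1 hν.2 (by simp)).pushf_eq⟩

/-- Theorem 3 (Han–Kobayashi auxiliary region via SWSC layer orders):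
`𝓡₁,MAC(p) ∩ 𝓡₂,MAC(p) = ⋃_{p' ≃ p} ⋃_{λ₁=1}^{6} ⋃_{λ₂=7}^{12} [𝓡₁(p',λ₁) ∩ 𝓡₂(p',λ₂)]`. -/
theorem hk_auxiliary_region_sw
    (pS : 𝒮 → ℝ) (pT : 𝒯 → ℝ) (pU : 𝒰 → ℝ) (pV : 𝒱 → ℝ)
    (fx : 𝒮 → 𝒯 → 𝒳) (fw : 𝒰 → 𝒱 → 𝒲) (ch : 𝒳 → 𝒲 → 𝒴₁ → 𝒴₂ → ℝ)
    (hpS : IsPMF pS) (hpT : IsPMF pT) (hpU : IsPMF pU) (hpV : IsPMF pV)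
    (hch0 : ∀ x w y₁ y₂, 0 ≤ ch x w y₁ y₂)
    (hch1 : ∀ x w, ∑ y₁, ∑ y₂, ch x w y₁ y₂ = 1) :
    R1MACHK pS pT pU pV fx fw ch ∩ R2MACHK pS pT pU pV fx fw ch
      = ⋃ (s : HKSplit 𝒮 𝒯 𝒰 𝒱) (_ : s.Matches pS pT pV)
          (l₁ : HKOrder1) (l₂ : HKOrder2),
            (R1Reg fx fw s pU ch l₁ ∩ R2Reg fx fw s pU ch l₂) := by
  have hW₁ := chan₁_isPMF hpV (fx := fx) (fw := fw) hch0 hch1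
  have hW₂ := chan₂_isPMF hpT (fx := fx) (fw := fw) hch0 hch1
  ext r
  simp only [Set.mem_inter_iff, Set.mem_iUnion, mem_R1MACHK_iff hpS hpT hpU hpV hch1,
    mem_R2MACHK_iff hpS hpT hpU hpV hch1, mem_R1Reg_iff hpU hch1, mem_R2Reg_iff hpU hch1]
  constructor
  · rintro ⟨⟨h0, h₁⟩, -, h₂⟩
    obtain ⟨a, τ, ha, ha', hτ, hτ', k, hb⟩ :=
      h₁.exists_splitBounds (macInfo_supermodular hpS hpT hpU hW₁)
    obtain ⟨b, ν, hb0, hb1, hν, hν', k', hb'⟩ :=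
      h₂.exists_splitBounds (macInfo_supermodular hpS hpV hpU hW₂)
    obtain ⟨s, hs, t, ht, early, early', rfl, rfl⟩ := exists_levels ⟨ha, ha'⟩ ⟨hb0, hb1⟩
    obtain ⟨o, ho⟩ := HKOrder1.exists_layers_eq early k
    obtain ⟨o', ho'⟩ := HKOrder2.exists_layers_eq early' k'
    have hm := HKSplit.matches_ofErased (𝒰 := 𝒰) hpS hpT hpV hs ht ⟨hτ, hτ'⟩ ⟨hν, hν'⟩
    refine ⟨_, hm, o, o', ⟨h0, ?_⟩, h0, ?_⟩
    · rw [ho, funext (splitInfo₁_eq hm fx fw pU ch)]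
      exact hb.scBounds_layerInfo hpS hpT hpU hW₁ hs ht ⟨hτ, hτ'⟩
    · rw [ho', funext (splitInfo₂_eq hm fx fw pU ch)]
      exact hb'.scBounds_layerInfo hpS hpV hpU hW₂ hs ht ⟨hν, hν'⟩
  · rintro ⟨s, hm, o, o', ⟨h0, h₁⟩, -, h₂⟩
    obtain ⟨mS, mT, mV⟩ := (s.matches_iff pS pT pV).1 hm
    rw [funext (splitInfo₁_eq hm fx fw pU ch)] at h₁
    rw [funext (splitInfo₂_eq hm fx fw pU ch)] at h₂
    exact ⟨⟨h0, macBounds_of_scBounds_layerInfo s.pS1_pmf s.pS2_pmf s.pS3_pmf s.pT1_pmf s.pT2_pmf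
        hpS hpT hpU hW₁ mS mT o.toFinset_layers h₁⟩,
      h0, macBounds_of_scBounds_layerInfo s.pS1_pmf s.pS2_pmf s.pS3_pmf s.pV1_pmf s.pV2_pmf
        hpS hpV hpU hW₂ mS mV o'.toFinset_layers h₂⟩
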